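/- arXiv:2304.11089 — 2 statements merged into one kernel-verified Lean document; each statement's English description precedes it below -/
import Mathlib

section
/- Let 0 < ε ≤ 1/24, n ≥ k/ε, and let F ⊂ binom([n], k) be an intersecting family with |F| ≥ 36·C(n-3, k-3). Then ρ(F) > 2/3 − ε. -/
section
open Finset

namespace St9

/-- single-set shift -/
def cs (i j : ℕ) (A : Finset ℕ) : Finset ℕ := if j ∈ A ∧ i ∉ A then insert i (A.erase j) else A

/-- shifted image of one member relative to the family -/
def ph (i j : ℕ) (s : Finset (Finset ℕ)) (A : Finset ℕ) : Finset ℕ :=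
  if cs i j A ∈ s then A else cs i j A

def sh (i j : ℕ) (s : Finset (Finset ℕ)) : Finset (Finset ℕ) := s.image (ph i j s)

def wt (s : Finset (Finset ℕ)) : ℕ := ∑ A ∈ s, ∑ x ∈ A, x

def Uni (n k : ℕ) (s : Finset (Finset ℕ)) : Prop := ∀ F ∈ s, F ⊆ Finset.Icc 1 n ∧ F.card = k

def Itr (s : Finset (Finset ℕ)) : Prop := ∀ F ∈ s, ∀ F' ∈ s, (F ∩ F').Nonempty

def Stable (X : Finset ℕ) (s : Finset (Finset ℕ)) : Prop :=
  ∀ i ∈ X, ∀ j ∈ X, i < j → ∀ A ∈ s, j ∈ A → i ∉ A → insert i (A.erase j) ∈ s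

theorem cs_injOn_aux {i j : ℕ} {A B : Finset ℕ} (hA : j ∈ A ∧ i ∉ A) (hB : j ∈ B ∧ i ∉ B)
    (h : cs i j A = cs i j B) : A = B := by
  simp only [cs, hA, hB, and_self, if_true, not_false_eq_true] at h
  ext x
  have hx := Finset.ext_iff.1 h x
  simp only [mem_insert, mem_erase] at hx
  by_cases h1 : x = i
  · subst h1; simp [hA.2, hB.2]
  · by_cases h2 : x = j
    · subst h2; simp [hA.1, hB.1]
    · simpa [h1, h2] using hx

theorem moved {i j : ℕ} {s : Finset (Finset ℕ)} {A : Finset ℕ} (hA : A ∈ s) (h : cs i j A ∉ s) :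
    j ∈ A ∧ i ∉ A := by
  by_contra hc
  apply h
  simp only [cs, if_neg hc]; exact hA

theorem ph_injOn (i j : ℕ) (s : Finset (Finset ℕ)) : Set.InjOn (ph i j s) s := by
  intro A hA B hB h
  have hA' : A ∈ s := hA
  have hB' : B ∈ s := hB
  unfold ph at h
  split_ifs at h with h1 h2 h2
  · exact h
  · exact absurd (h ▸ hA') h2
  · exact absurd (h ▸ hB') h1
  · exact cs_injOn_aux (moved hA' h1) (moved hB' h2) h

theorem card_sh (i j : ℕ) (s : Finset (Finset ℕ)) : #(sh i j s) = #s :=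
  card_image_of_injOn (ph_injOn i j s)

/-- members of the shifted family, three properties -/
theorem mem_sh {i j : ℕ} {s : Finset (Finset ℕ)} {B : Finset ℕ} (h : B ∈ sh i j s) :
    (B ∈ s ∧ cs i j B ∈ s) ∨
      (∃ A ∈ s, (j ∈ A ∧ i ∉ A) ∧ B = insert i (A.erase j) ∧ B ∉ s) := by
  obtain ⟨A, hA, rfl⟩ := mem_image.1 h
  unfold ph
  split_ifs with h1
  · exact Or.inl ⟨hA, h1⟩
  · have hm := moved hA h1
    refine Or.inr ⟨A, hA, hm, ?_, h1⟩
    simp [cs, hm]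

theorem uni_sh {n k i j : ℕ} {s : Finset (Finset ℕ)} (hi : i ∈ Icc 1 n) (h : Uni n k s) :
    Uni n k (sh i j s) := by
  intro B hB
  rcases mem_sh hB with hB | ⟨A, hA, hm, rfl, -⟩
  · exact h B hB.1
  · obtain ⟨h1, h2⟩ := h A hA
    constructor
    · intro x hx
      rcases mem_insert.1 hx with rfl | hx
      · exact hi
      · exact h1 (mem_of_mem_erase hx)
    · rw [card_insert_of_notMem (fun hx => hm.2 (mem_of_mem_erase hx)), card_erase_of_mem hm.1]
      have := card_pos.2 ⟨j, hm.1⟩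
      omega

theorem itr_sh {i j : ℕ} {s : Finset (Finset ℕ)} (h : Itr s) : Itr (sh i j s) := by
  have key : ∀ A ∈ s, cs i j A ∈ s → ∀ B0 ∈ s, (j ∈ B0 ∧ i ∉ B0) →
      (A ∩ insert i (B0.erase j)).Nonempty := by
    intro A hA hcA B0 hB0 hm
    by_cases hiA : i ∈ A
    · exact ⟨i, by simp [hiA]⟩
    by_cases hjA : j ∈ A
    · have hc : insert i (A.erase j) ∈ s := by simpa [cs, hiA, hjA] using hcA
      obtain ⟨y, hy⟩ := h _ hc _ hB0
      simp only [mem_inter, mem_insert, mem_erase] at hy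
      refine ⟨y, ?_⟩
      simp only [mem_inter, mem_insert, mem_erase]
      rcases hy with ⟨rfl | ⟨h1, h2⟩, h3⟩
      · exact absurd h3 hm.2
      · exact ⟨h2, Or.inr ⟨h1, h3⟩⟩
    · obtain ⟨y, hy⟩ := h _ hA _ hB0
      simp only [mem_inter] at hy
      refine ⟨y, ?_⟩
      simp only [mem_inter, mem_insert, mem_erase]
      exact ⟨hy.1, Or.inr ⟨fun e => hjA (e ▸ hy.1), hy.2⟩⟩
  intro A hA B hB
  rcases mem_sh hA with hA | ⟨A0, hA0, hmA, rfl, -⟩ <;>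
    rcases mem_sh hB with hB | ⟨B0, hB0, hmB, rfl, -⟩
  · exact h A hA.1 B hB.1
  · exact key A hA.1 hA.2 B0 hB0 hmB
  · rw [inter_comm]; exact key B hB.1 hB.2 A0 hA0 hmA
  · exact ⟨i, by simp⟩

theorem filter_sh {i j : ℕ} {s : Finset (Finset ℕ)} (P : Finset ℕ → Prop) [DecidablePred P]
    (hP : ∀ A, P (cs i j A) ↔ P A) : #((sh i j s).filter P) = #(s.filter P) := by
  have : (sh i j s).filter P = (s.filter P).image (ph i j s) := by
    unfold sh
    rw [filter_image]
    congr 1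
    apply filter_congr
    intro A _
    unfold ph
    split_ifs
    · rfl
    · exact hP A
  rw [this]
  exact card_image_of_injOn ((ph_injOn i j s).mono
    (fun x hx => (mem_filter.1 (mem_coe.1 hx)).1))

theorem deg_other {i j v : ℕ} {s : Finset (Finset ℕ)} (h1 : v ≠ i) (h2 : v ≠ j) :
    #((sh i j s).filter (fun F => v ∈ F)) = #(s.filter (fun F => v ∈ F)) := by
  apply filter_sh
  intro A
  unfold cs
  split_ifs <;> simp [h1, h2]

theorem deg_j {i j : ℕ} (hij : i ≠ j) {s : Finset (Finset ℕ)} :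
    #((sh i j s).filter (fun F => j ∈ F)) ≤ #(s.filter (fun F => j ∈ F)) := by
  apply card_le_card
  intro B hB
  rw [mem_filter] at hB ⊢
  rcases mem_sh hB.1 with h | ⟨A, hA, hm, rfl, -⟩
  · exact ⟨h.1, hB.2⟩
  · have := hB.2
    simp [hij.symm] at this

theorem deg_i {i j : ℕ} {s : Finset (Finset ℕ)} :
    #((sh i j s).filter (fun F => i ∈ F)) ≤ #(s.filter (fun F => i ∈ F ∨ j ∈ F)) := by
  rw [← filter_sh (i := i) (j := j) (s := s) (fun F => i ∈ F ∨ j ∈ F)]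
  · apply card_le_card
    intro B hB
    rw [mem_filter] at hB ⊢
    exact ⟨hB.1, Or.inl hB.2⟩
  · intro A
    unfold cs
    split_ifs with h
    · simp [h.1]
    · rfl

theorem wt_sh {i j : ℕ} (hij : i < j) {s : Finset (Finset ℕ)} {A : Finset ℕ} (hA : A ∈ s)
    (hc : cs i j A ∉ s) : wt (sh i j s) < wt s := by
  unfold wt sh
  rw [sum_image (ph_injOn i j s)]
  have key : ∀ B ∈ s, cs i j B ∉ s → ∑ x ∈ ph i j s B, x < ∑ x ∈ B, x := by
    intro B hB hcB
    have hm := moved hB hcB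
    have : ph i j s B = insert i (B.erase j) := by
      simp only [ph, if_neg hcB]; simp [cs, hm]
    rw [this, sum_insert (fun hx => hm.2 (mem_of_mem_erase hx)), ← add_sum_erase B (fun x => x) hm.1]
    omega
  apply sum_lt_sum
  · intro B hB
    by_cases hcB : cs i j B ∈ s
    · simp [ph, hcB]
    · exact (key B hB hcB).le
  · exact ⟨A, hA, key A hA hc⟩

theorem exists_min (Q : Finset (Finset ℕ) → Prop) (s0 : Finset (Finset ℕ)) (h0 : Q s0) :
    ∃ s, Q s ∧ ∀ i j, i < j → Q (sh i j s) →
      ∀ A ∈ s, j ∈ A → i ∉ A → insert i (A.erase j) ∈ s := by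
  obtain ⟨s, hs, hmin⟩ := (measure wt).wf.has_min {s | Q s} ⟨s0, h0⟩
  refine ⟨s, hs, fun i j hij hQ A hA hj hi => ?_⟩
  by_contra hc
  refine hmin _ hQ (wt_sh hij hA ?_)
  simpa [cs, hj, hi] using hc

/-- key disjointness lemma -/
theorem no_pair {X : Finset ℕ} {s : Finset (Finset ℕ)} (hI : Itr s) (hS : Stable X s) :
    ∀ m : ℕ, ∀ F ∈ s, ∀ F' ∈ s, #(F ∩ F') = m →
      (∀ y ∈ F ∩ F', y ∈ X ∧ #(F ∩ X.filter (· ≤ y)) + #(F' ∩ X.filter (· ≤ y)) ≤ #(X.filter (· ≤ y)))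
      → False := by
  intro m
  induction m with
  | zero =>
    intro F hF F' hF' hc _
    have := card_pos.2 (hI F hF F' hF')
    omega
  | succ m ih =>
    intro F hF F' hF' hc h
    have hne := hI F hF F' hF'
    set y := (F ∩ F').min' hne with hy
    have hyI : y ∈ F ∩ F' := min'_mem _ _
    have hyF := (mem_inter.1 hyI).1
    have hyF' := (mem_inter.1 hyI).2
    have hmin : ∀ z ∈ F ∩ F', y ≤ z := fun z hz => min'_le _ _ hz
    obtain ⟨hyX, hcnt⟩ := h y hyI
    have hx : ∃ x ∈ X.filter (· ≤ y), x ∉ F ∪ F' := by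
      by_contra hcon
      push Not at hcon
      have h1 : X.filter (· ≤ y) ⊆ (F ∩ X.filter (· ≤ y)) ∪ (F' ∩ X.filter (· ≤ y)) := by
        intro x hx
        have := hcon x hx
        rw [mem_union] at this
        rw [mem_union, mem_inter, mem_inter]
        tauto
      have h2 := card_le_card h1
      have h3 := card_union_add_card_inter (F ∩ X.filter (· ≤ y)) (F' ∩ X.filter (· ≤ y))
      have h4 : 0 < #((F ∩ X.filter (· ≤ y)) ∩ (F' ∩ X.filter (· ≤ y))) := by
        apply card_pos.2
        refine ⟨y, ?_⟩
        simp [hyF, hyF', hyX]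
      omega
    obtain ⟨x, hx, hxn⟩ := hx
    rw [mem_filter] at hx
    rw [mem_union, not_or] at hxn
    have hxy : x < y := lt_of_le_of_ne hx.2 (fun e => hxn.1 (e ▸ hyF))
    have hF1 := hS x hx.1 y hyX hxy F hF hyF hxn.1
    have hint : insert x (F.erase y) ∩ F' = (F ∩ F').erase y := by
      ext z
      simp only [mem_inter, mem_insert, mem_erase]
      constructor
      · rintro ⟨rfl | h1, h2⟩
        · exact absurd h2 hxn.2
        · exact ⟨h1.1, h1.2, h2⟩
      · rintro ⟨h1, h2, h3⟩
        exact ⟨Or.inr ⟨h1, h2⟩, h3⟩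
    refine ih _ hF1 F' hF' ?_ ?_
    · rw [hint, card_erase_of_mem hyI, hc]; rfl
    · intro z hz
      rw [hint, mem_erase] at hz
      obtain ⟨hzX, hzc⟩ := h z hz.2
      refine ⟨hzX, ?_⟩
      have hyz : y < z := lt_of_le_of_ne (hmin z hz.2) (Ne.symm hz.1)
      have : insert x (F.erase y) ∩ X.filter (· ≤ z) = insert x ((F ∩ X.filter (· ≤ z)).erase y) := by
        ext w
        simp only [mem_inter, mem_insert, mem_erase, mem_filter]
        constructor
        · rintro ⟨rfl | h1, h2⟩
          · exact Or.inl rfl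
          · exact Or.inr ⟨h1.1, h1.2, h2⟩
        · rintro (rfl | ⟨h1, h2, h3⟩)
          · exact ⟨Or.inl rfl, hx.1, by omega⟩
          · exact ⟨Or.inr ⟨h1, h2⟩, h3⟩
      rw [this, card_insert_of_notMem (by simp [hxn.1]), card_erase_of_mem (by simp [hyF, hyX, hyz.le])]
      have hp : 0 < #(F ∩ X.filter (· ≤ z)) := card_pos.2 ⟨y, by simp [hyF, hyX, hyz.le]⟩
      omega

/-- the first `z` elements of `X` -/
def pre (X : Finset ℕ) (z : ℕ) : Finset ℕ := X.filter (fun x => #(X.filter (· ≤ x)) ≤ z)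

theorem pre_sub (X : Finset ℕ) (z : ℕ) : pre X z ⊆ X := filter_subset _ _

theorem card_pre (X : Finset ℕ) (z : ℕ) : #(pre X z) ≤ z := by
  rcases (pre X z).eq_empty_or_nonempty with h | h
  · simp [h]
  · have hm := max'_mem _ h
    have h2 := (mem_filter.1 hm).2
    refine le_trans (card_le_card ?_) h2
    intro x hx
    exact mem_filter.2 ⟨pre_sub X z hx, le_max' _ _ hx⟩

theorem pre_mono (X : Finset ℕ) {z z' : ℕ} (h : z ≤ z') : pre X z ⊆ pre X z' := by
  intro x hx
  rw [pre, mem_filter] at hx ⊢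
  exact ⟨hx.1, hx.2.trans h⟩

theorem le_pre (X : Finset ℕ) (y : ℕ) {z : ℕ} (h : #(X.filter (· ≤ y)) ≤ z) :
    X.filter (· ≤ y) ⊆ pre X z := by
  intro x hx
  rw [mem_filter] at hx
  rw [pre, mem_filter]
  refine ⟨hx.1, le_trans (card_le_card ?_) h⟩
  intro w hw
  rw [mem_filter] at hw ⊢
  exact ⟨hw.1, hw.2.trans hx.2⟩

end St9

namespace St9

noncomputable def c0 (n k : ℕ) : ℝ := ((n - 3).choose (k - 3) : ℝ)
noncomputable def pp (n k : ℕ) : ℝ := (k : ℝ) / n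

theorem c0_nonneg (n k : ℕ) : 0 ≤ c0 n k := by unfold c0; positivity
theorem pp_nonneg (n k : ℕ) : 0 ≤ pp n k := by unfold pp; positivity
theorem pp_le {n k : ℕ} (hk : 1 ≤ k) (hn : 24 * k ≤ n) : pp n k ≤ 1 / 24 := by
  unfold pp
  have h : (24 : ℝ) * k ≤ n := by exact_mod_cast hn
  have : (1 : ℝ) ≤ k := by exact_mod_cast hk
  rw [div_le_div_iff₀ (by linarith) (by norm_num)]
  linarith

theorem choose_le {n k : ℕ} (hk : 1 ≤ k) (hn : 24 * k ≤ n) (m : ℕ) (h : m + 3 ≤ k) :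
    ((n - (m + 3)).choose (k - (m + 3)) : ℝ) ≤ c0 n k * pp n k ^ m := by
  induction m with
  | zero => simp [c0]
  | succ m ih =>
    have ih := ih (by omega)
    obtain ⟨a, rfl⟩ : ∃ a, k = a + 1 + (m + 3) := ⟨k - (m + 4), by omega⟩
    obtain ⟨b, rfl⟩ : ∃ b, n = b + 1 + (m + 3) := ⟨n - (m + 4), by omega⟩
    rw [show a + 1 + (m + 3) - (m + 3) = a + 1 by omega,
      show b + 1 + (m + 3) - (m + 3) = b + 1 by omega] at ih
    rw [show a + 1 + (m + 3) - (m + 1 + 3) = a by omega,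
      show b + 1 + (m + 3) - (m + 1 + 3) = b by omega]
    have e : ((b : ℝ) + 1) * (b.choose a : ℝ) = ((b + 1).choose (a + 1) : ℝ) * (a + 1) := by
      exact_mod_cast Nat.add_one_mul_choose_eq b a
    have hab : (a : ℝ) ≤ b := by
      have : a ≤ b := by omega
      exact_mod_cast this
    have hb : (0 : ℝ) ≤ b := by positivity
    have ha : (0 : ℝ) ≤ a := by positivity
    have h1 : (b.choose a : ℝ) = ((b + 1).choose (a + 1) : ℝ) * ((a + 1) / (b + 1)) := by
      field_simp; linarith
    have h2 : ((a : ℝ) + 1) / (b + 1) ≤ pp (b + 1 + (m + 3)) (a + 1 + (m + 3)) := by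
      unfold pp
      push_cast
      rw [div_le_div_iff₀ (by linarith) (by positivity)]
      have : (0 : ℝ) ≤ m := by positivity
      nlinarith
    rw [h1, pow_succ, ← mul_assoc]
    exact mul_le_mul ih h2 (by positivity) (mul_nonneg (c0_nonneg _ _) (pow_nonneg (pp_nonneg _ _) _))

theorem cnt {n k : ℕ} (hk : 1 ≤ k) (hn : 24 * k ≤ n) {s : Finset (Finset ℕ)} (hs : Uni n k s)
    (S : Finset ℕ) (h3 : 3 ≤ #S) :
    (#(s.filter (fun F => S ⊆ F)) : ℝ) ≤ c0 n k * pp n k ^ (#S - 3) := by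
  rcases (s.filter (fun F => S ⊆ F)).eq_empty_or_nonempty with h | ⟨F0, hF0⟩
  · rw [h]
    simpa using mul_nonneg (c0_nonneg n k) (pow_nonneg (pp_nonneg n k) _)
  rw [mem_filter] at hF0
  have hSI : S ⊆ Icc 1 n := hF0.2.trans (hs _ hF0.1).1
  have hSk : #S ≤ k := by rw [← (hs _ hF0.1).2]; exact card_le_card hF0.2
  have h1 : #(s.filter (fun F => S ⊆ F)) ≤ (n - #S).choose (k - #S) := by
    have : #(powersetCard (k - #S) (Icc 1 n \ S)) = (n - #S).choose (k - #S) := by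
      rw [card_powersetCard, card_sdiff_of_subset hSI]; simp
    rw [← this]
    apply card_le_card_of_injOn (fun F => F \ S)
    · intro F hF
      rw [mem_coe, mem_filter] at hF
      rw [mem_coe, mem_powersetCard]
      refine ⟨sdiff_subset_sdiff (hs _ hF.1).1 (le_refl S), ?_⟩
      rw [card_sdiff_of_subset hF.2, (hs _ hF.1).2]
    · intro F hF F' hF' h
      rw [mem_coe, mem_filter] at hF hF'
      have h : F \ S = F' \ S := h
      rw [← sdiff_union_of_subset hF.2, ← sdiff_union_of_subset hF'.2, h]
  have h2 := choose_le hk hn (#S - 3) (by omega)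
  rw [show #S - 3 + 3 = #S by omega] at h2
  exact le_trans (by exact_mod_cast h1) h2

/-- union bound -/
theorem cnt_union {α : Type*} {s : Finset (Finset ℕ)} (I : Finset α)
    (P : Finset ℕ → Prop) [DecidablePred P] (R : α → Finset ℕ → Prop) [∀ a, DecidablePred (R a)]
    (h : ∀ F ∈ s, P F → ∃ a ∈ I, R a F) (b : α → ℝ)
    (hb : ∀ a ∈ I, (#(s.filter (R a)) : ℝ) ≤ b a) :
    (#(s.filter P) : ℝ) ≤ ∑ a ∈ I, b a := by
  classical
  have h1 : s.filter P ⊆ I.biUnion (fun a => s.filter (R a)) := by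
    intro F hF
    rw [mem_filter] at hF
    obtain ⟨a, ha, hR⟩ := h F hF.1 hF.2
    exact mem_biUnion.2 ⟨a, ha, mem_filter.2 ⟨hF.1, hR⟩⟩
  have h2 := (card_le_card h1).trans card_biUnion_le
  calc (#(s.filter P) : ℝ) ≤ ((∑ a ∈ I, #(s.filter (R a)) : ℕ) : ℝ) := by exact_mod_cast h2
    _ = ∑ a ∈ I, (#(s.filter (R a)) : ℝ) := by push_cast; rfl
    _ ≤ _ := sum_le_sum hb

theorem cntW {n k : ℕ} (hk : 1 ≤ k) (hn : 24 * k ≤ n) {s : Finset (Finset ℕ)} (hs : Uni n k s)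
    (D W : Finset ℕ) (hDW : Disjoint D W) (w h : ℕ) (hw : #W ≤ w) (h3 : 3 ≤ #D + h) :
    (#(s.filter (fun F => D ⊆ F ∧ h ≤ #(F ∩ W))) : ℝ) ≤
      (w.choose h : ℝ) * (c0 n k * pp n k ^ (#D + h - 3)) := by
  have h1 := cnt_union (s := s) (powersetCard h W) (fun F => D ⊆ F ∧ h ≤ #(F ∩ W))
    (fun S F => D ∪ S ⊆ F) (by
      rintro F hF ⟨h1, h2⟩
      obtain ⟨S, hS, hc⟩ := exists_subset_card_eq h2
      refine ⟨S, mem_powersetCard.2 ⟨hS.trans inter_subset_right, hc⟩, ?_⟩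
      exact union_subset h1 (hS.trans inter_subset_left))
    (fun _ => c0 n k * pp n k ^ (#D + h - 3)) (by
      intro S hS
      rw [mem_powersetCard] at hS
      have hc : #(D ∪ S) = #D + h := by
        rw [card_union_of_disjoint (hDW.mono_right hS.1), hS.2]
      have := cnt hk hn hs (D ∪ S) (by omega)
      rwa [hc] at this)
  refine h1.trans ?_
  rw [sum_const, card_powersetCard, nsmul_eq_mul]
  apply mul_le_mul_of_nonneg_right _ (mul_nonneg (c0_nonneg n k) (pow_nonneg (pp_nonneg n k) _))
  exact_mod_cast Nat.choose_le_choose h hw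

theorem geom6 (m : ℕ) : ∑ i ∈ range m, (1 / 6 : ℝ) ^ i ≤ 6 / 5 := by
  have := geom_sum_eq (show (1 / 6 : ℝ) ≠ 1 by norm_num) m
  rw [this]
  have h : (0 : ℝ) ≤ (1 / 6) ^ m := by positivity
  rw [div_le_iff_of_neg (by norm_num)]
  linarith

theorem choose_odd (m : ℕ) : ((2 * m + 7).choose (m + 4)) ≤ 35 * 4 ^ m := by
  induction m with
  | zero => decide
  | succ m ih =>
    have h1 : (2 * (m + 1) + 7).choose (m + 1 + 4) = (2 * m + 8).choose (m + 4) + (2 * m + 8).choose (m + 5) := by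
      rw [show 2 * (m + 1) + 7 = (2 * m + 8) + 1 by ring, show m + 1 + 4 = (m + 4) + 1 by ring,
        Nat.choose_succ_succ]
    have h2 : (2 * m + 8).choose (m + 5) ≤ (2 * m + 8).choose (m + 4) := by
      have := Nat.choose_le_centralBinom (m + 5) (m + 4)
      rw [Nat.centralBinom] at this
      rwa [show 2 * (m + 4) = 2 * m + 8 by ring] at this
    have h3 : (2 * m + 8).choose (m + 4) = (2 * m + 7).choose (m + 3) + (2 * m + 7).choose (m + 4) :=
      Nat.choose_succ_succ _ _
    have h4 : (2 * m + 7).choose (m + 3) = (2 * m + 7).choose (m + 4) :=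
      Nat.choose_symm_of_eq_add (by omega)
    rw [pow_succ]
    omega

theorem choose_odd' (m : ℕ) : ((2 * m + 3).choose (m + 1)) ≤ 3 * 4 ^ m := by
  induction m with
  | zero => decide
  | succ m ih =>
    have h1 : (2 * (m + 1) + 3).choose (m + 1 + 1) = (2 * m + 4).choose (m + 1) + (2 * m + 4).choose (m + 2) := by
      rw [show 2 * (m + 1) + 3 = (2 * m + 4) + 1 by ring, 
        Nat.choose_succ_succ]
    have h2 : (2 * m + 4).choose (m + 1) ≤ (2 * m + 4).choose (m + 2) := by
      have := Nat.choose_le_centralBinom (m + 1) (m + 2)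
      rw [Nat.centralBinom] at this
      rwa [show 2 * (m + 2) = 2 * m + 4 by ring] at this
    have h3 : (2 * m + 4).choose (m + 2) = (2 * m + 3).choose (m + 1) + (2 * m + 3).choose (m + 2) :=
      Nat.choose_succ_succ _ _
    have h4 : (2 * m + 3).choose (m + 1) = (2 * m + 3).choose (m + 2) :=
      Nat.choose_symm_of_eq_add (by omega)
    rw [pow_succ]
    omega

/-- weighted geometric series bound -/
theorem series {n k : ℕ} (hk : 1 ≤ k) (hn : 24 * k ≤ n) (m d a : ℕ) (f : ℕ → ℕ)
    (hf : ∀ i, f i ≤ a * 4 ^ i) :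
    ∑ i ∈ range m, (f i : ℝ) * (c0 n k * pp n k ^ (i + d)) ≤ a * (6 / 5) * (c0 n k * pp n k ^ d) := by
  have hp := pp_le hk hn
  have hp0 := pp_nonneg n k
  have hc := c0_nonneg n k
  have h1 : ∀ i ∈ range m, (f i : ℝ) * (c0 n k * pp n k ^ (i + d)) ≤
      (1 / 6 : ℝ) ^ i * (a * (c0 n k * pp n k ^ d)) := by
    intro i _
    have h2 : (f i : ℝ) ≤ a * 4 ^ i := by exact_mod_cast hf i
    have h3 : pp n k ^ i ≤ (1 / 24) ^ i := pow_le_pow_left₀ hp0 hp i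
    calc (f i : ℝ) * (c0 n k * pp n k ^ (i + d)) = f i * pp n k ^ i * (c0 n k * pp n k ^ d) := by
          rw [pow_add]; ring
      _ ≤ (a * 4 ^ i) * (1 / 24) ^ i * (c0 n k * pp n k ^ d) := by gcongr
      _ = _ := by
        rw [show (1 / 6 : ℝ) = 4 * (1 / 24) by norm_num, mul_pow]; ring
  refine (sum_le_sum h1).trans ?_
  rw [← sum_mul]
  have := geom6 m
  have h4 : 0 ≤ (a * (c0 n k * pp n k ^ d)) := by positivity
  nlinarith

/-- EKR on an arbitrary finite ground set -/
theorem ekr (S : Finset ℕ) (r : ℕ) (s : Finset (Finset ℕ)) (hs : ∀ A ∈ s, A ⊆ S ∧ #A = r)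
    (hI : Itr s) (hr : 2 * r ≤ #S) : #s ≤ (#S - 1).choose (r - 1) := by
  classical
  let e := S.orderEmbOfFin rfl
  have he : ∀ x ∈ S, ∃ i, e i = x := by
    intro x hx
    have := Finset.range_orderEmbOfFin S rfl
    have h2 : x ∈ Set.range e := by rw [this]; exact hx
    exact h2
  let g : Finset ℕ → Finset (Fin #S) := fun A => univ.filter (fun i => e i ∈ A)
  have hg : ∀ A, A ⊆ S → (g A).map e.toEmbedding = A := by
    intro A hA
    ext x
    simp only [mem_map, g, mem_filter, mem_univ, true_and]
    constructor
    · rintro ⟨i, hi, rfl⟩; exact hi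
    · intro hx
      obtain ⟨i, rfl⟩ := he x (hA hx)
      exact ⟨i, hx, rfl⟩
  have hinj : Set.InjOn g s := by
    intro A hA B hB h
    rw [← hg A (hs A hA).1, ← hg B (hs B hB).1, h]
  rw [← card_image_of_injOn hinj]
  apply Finset.erdos_ko_rado
  · intro A hA B hB hd
    obtain ⟨A, hA', rfl⟩ := mem_image.1 (mem_coe.1 hA)
    obtain ⟨B, hB', rfl⟩ := mem_image.1 (mem_coe.1 hB)
    obtain ⟨x, hx⟩ := hI A hA' B hB'
    rw [mem_inter] at hx
    obtain ⟨i, rfl⟩ := he x ((hs A hA').1 hx.1)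
    exact (disjoint_left.1 hd) (show i ∈ g A by simp [g, hx.1]) (show i ∈ g B by simp [g, hx.2])
  · intro A hA
    obtain ⟨A, hA', rfl⟩ := mem_image.1 (mem_coe.1 hA)
    rw [← card_map e.toEmbedding, hg A (hs A hA').1, (hs A hA').2]
  · omega

end St9

namespace St9

theorem cnt_or {s : Finset (Finset ℕ)} {P Q : Finset ℕ → Prop} [DecidablePred P] [DecidablePred Q]
    {a b : ℝ} (hP : (#(s.filter P) : ℝ) ≤ a) (hQ : (#(s.filter Q) : ℝ) ≤ b) :
    (#(s.filter (fun F => P F ∨ Q F)) : ℝ) ≤ a + b := by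
  have h : #(s.filter (fun F => P F ∨ Q F)) ≤ #(s.filter P) + #(s.filter Q) := by
    rw [filter_or]; exact card_union_le _ _
  have h' : (#(s.filter (fun F => P F ∨ Q F)) : ℝ) ≤ #(s.filter P) + #(s.filter Q) := by
    exact_mod_cast h
  linarith

theorem cnt_mono {s : Finset (Finset ℕ)} {P Q : Finset ℕ → Prop} [DecidablePred P] [DecidablePred Q]
    (h : ∀ F ∈ s, P F → Q F) : (#(s.filter P) : ℝ) ≤ #(s.filter Q) := by
  have : #(s.filter P) ≤ #(s.filter Q) := by
    apply card_le_card
    intro F hF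
    rw [mem_filter] at hF ⊢
    exact ⟨hF.1, h F hF.1 hF.2⟩
  exact_mod_cast this

theorem cnt4 {n k : ℕ} (hk : 1 ≤ k) (hn : 24 * k ≤ n) {s : Finset (Finset ℕ)} (hs : Uni n k s)
    (a b c d : ℕ) (h : [a, b, c, d].Nodup) :
    (#(s.filter (fun F => a ∈ F ∧ b ∈ F ∧ c ∈ F ∧ d ∈ F)) : ℝ) ≤ c0 n k * pp n k := by
  have hc : #({a, b, c, d} : Finset ℕ) = 4 := by
    have : ({a, b, c, d} : Finset ℕ) = [a, b, c, d].toFinset := by simp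
    rw [this, List.toFinset_card_of_nodup h]; rfl
  have h1 := cnt hk hn hs {a, b, c, d} (by omega)
  rw [hc] at h1
  norm_num at h1
  refine le_trans (cnt_mono ?_) h1
  rintro F _ ⟨h1, h2, h3, h4⟩
  simp [insert_subset_iff, h1, h2, h3, h4]

theorem cntQ {n k : ℕ} (hk : 1 ≤ k) (hn : 24 * k ≤ n) {s : Finset (Finset ℕ)} (hs : Uni n k s)
    (a b c d e f : ℕ) (h : [a, b, c, d, e, f].Nodup) :
    (#(s.filter (fun F => a ∈ F ∧ b ∈ F ∧ (c ∈ F ∨ d ∈ F) ∧ (e ∈ F ∨ f ∈ F))) : ℝ) ≤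
      4 * (c0 n k * pp n k) := by
  simp only [List.nodup_cons, List.mem_cons, not_or, List.not_mem_nil, not_false_eq_true,
    List.nodup_nil, and_true] at h
  have h1 := cnt4 hk hn hs a b c e (by simp; tauto)
  have h2 := cnt4 hk hn hs a b c f (by simp; tauto)
  have h3 := cnt4 hk hn hs a b d e (by simp; tauto)
  have h4 := cnt4 hk hn hs a b d f (by simp; tauto)
  have h5 := cnt_or (cnt_or h1 h2) (cnt_or h3 h4)
  refine le_trans (cnt_mono ?_) (h5.trans (by linarith))
  intro F _
  tauto

theorem cntZ {n k : ℕ} (hk : 1 ≤ k) (hn : 24 * k ≤ n) {s : Finset (Finset ℕ)} (hs : Uni n k s)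
    (hI : Itr s) (a b x x' y y' : ℕ) (h : [a, b, x, x', y, y'].Nodup) :
    (#(s.filter (fun F => (a ∈ F ∧ b ∉ F ∧ x ∈ F ∧ x' ∉ F ∧ y ∈ F ∧ y' ∉ F) ∨
      (a ∉ F ∧ b ∈ F ∧ x ∉ F ∧ x' ∈ F ∧ y ∉ F ∧ y' ∈ F))) : ℝ) ≤ c0 n k := by
  set Z := s.filter (fun F => (a ∈ F ∧ b ∉ F ∧ x ∈ F ∧ x' ∉ F ∧ y ∈ F ∧ y' ∉ F) ∨
      (a ∉ F ∧ b ∈ F ∧ x ∉ F ∧ x' ∈ F ∧ y ∉ F ∧ y' ∈ F)) with hZ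
  rcases Z.eq_empty_or_nonempty with h0 | ⟨F0, hF0⟩
  · rw [h0]; simpa using c0_nonneg n k
  have hZs : ∀ F ∈ Z, F ∈ s := fun F hF => (mem_filter.1 hF).1
  simp only [List.nodup_cons, List.mem_cons, not_or, List.not_mem_nil, not_false_eq_true,
    List.nodup_nil, and_true] at h
  obtain ⟨⟨hab, hax, hax', hay, hay'⟩, ⟨hbx, hbx', hby, hby'⟩, ⟨hxx', hxy, hxy'⟩, ⟨hx'y, hx'y'⟩, hyy'⟩ := h
  set W : Finset ℕ := {x, x', y, y'} with hW
  have hWc : #W = 4 := by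
    rw [hW, card_insert_of_notMem, card_insert_of_notMem, card_insert_of_notMem, card_singleton] <;>
      simp [*]
  have htr : ∀ F ∈ Z, (a ∈ F ∧ b ∉ F ∧ F ∩ W = {x, y}) ∨ (a ∉ F ∧ b ∈ F ∧ F ∩ W = {x', y'}) := by
    intro F hF
    rcases (mem_filter.1 hF).2 with ⟨h1, h2, h3, h4, h5, h6⟩ | ⟨h1, h2, h3, h4, h5, h6⟩
    · refine Or.inl ⟨h1, h2, ?_⟩
      ext z
      simp only [hW, mem_inter, mem_insert, mem_singleton]
      constructor
      · rintro ⟨hz, rfl | rfl | rfl | rfl⟩ <;> tauto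
      · rintro (rfl | rfl) <;> tauto
    · refine Or.inr ⟨h1, h2, ?_⟩
      ext z
      simp only [hW, mem_inter, mem_insert, mem_singleton]
      constructor
      · rintro ⟨hz, rfl | rfl | rfl | rfl⟩ <;> tauto
      · rintro (rfl | rfl) <;> tauto
  have hcard : ∀ F ∈ Z, #(F ∩ W) = 2 := by
    intro F hF
    rcases htr F hF with h | h <;> rw [h.2.2]
    · exact card_pair hxy
    · exact card_pair hx'y'
  have hinj : Set.InjOn (fun F => F \ W) Z := by
    intro F hF F' hF' he
    have he : F \ W = F' \ W := he
    have haW : a ∉ W := by simp [hW, *]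
    have haa : a ∈ F ↔ a ∈ F' := by
      have := Finset.ext_iff.1 he a
      simpa [haW] using this
    have : F ∩ W = F' ∩ W := by
      rcases htr F hF with h | h <;> rcases htr F' hF' with h' | h'
      · rw [h.2.2, h'.2.2]
      · tauto
      · tauto
      · rw [h.2.2, h'.2.2]
    rw [← sdiff_union_inter F W, ← sdiff_union_inter F' W, he, this]
  have hF0s := hs F0 (hZs F0 hF0)
  have hk3 : 3 ≤ k := by
    have h1 : #(F0 \ W) + #(F0 ∩ W) = #F0 := card_sdiff_add_card_inter F0 W
    have h2 : 0 < #(F0 \ W) := by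
      apply card_pos.2
      rcases htr F0 hF0 with h | h
      · exact ⟨a, by simp [hW, *]⟩
      · exact ⟨b, by simp [hW, *]⟩
    rw [hcard F0 hF0, hF0s.2] at h1
    omega
  have hS : #(Icc 1 n) - 4 ≤ #(Icc 1 n \ W) := by
    rw [← hWc]; exact le_card_sdiff _ _
  obtain ⟨S, hSs, hSu, hSc⟩ : ∃ S, (Icc 1 n \ W) ⊆ S ∧ S ⊆ Icc 1 n \ W ∧ S = Icc 1 n \ W :=
    ⟨_, le_refl _, le_refl _, rfl⟩
  have key := ekr (Icc 1 n \ W) (k - 2) (Z.image (fun F => F \ W)) (by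
      intro A hA
      obtain ⟨F, hF, rfl⟩ := mem_image.1 hA
      refine ⟨sdiff_subset_sdiff (hs F (hZs F hF)).1 (le_refl _), ?_⟩
      have h1 : #(F \ W) + #(F ∩ W) = #F := card_sdiff_add_card_inter F W
      rw [hcard F hF, (hs F (hZs F hF)).2] at h1
      show #(F \ W) = k - 2
      omega) (by
      intro A hA B hB
      obtain ⟨F, hF, rfl⟩ := mem_image.1 hA
      obtain ⟨F', hF', rfl⟩ := mem_image.1 hB
      rcases htr F hF with h | h <;> rcases htr F' hF' with h' | h'
      · exact ⟨a, by simp [hW, *]⟩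
      · obtain ⟨z, hz⟩ := hI F (hZs F hF) F' (hZs F' hF')
        rw [mem_inter] at hz
        refine ⟨z, ?_⟩
        simp only [mem_inter, mem_sdiff]
        have hzW : z ∉ W := by
          intro hzW
          have h1 : z ∈ F ∩ W := mem_inter.2 ⟨hz.1, hzW⟩
          have h2 : z ∈ F' ∩ W := mem_inter.2 ⟨hz.2, hzW⟩
          rw [h.2.2] at h1
          rw [h'.2.2] at h2
          simp only [mem_insert, mem_singleton] at h1 h2
          rcases h1 with rfl | rfl <;> rcases h2 with rfl | rfl <;> tauto
        tauto
      · obtain ⟨z, hz⟩ := hI F (hZs F hF) F' (hZs F' hF')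
        rw [mem_inter] at hz
        refine ⟨z, ?_⟩
        simp only [mem_inter, mem_sdiff]
        have hzW : z ∉ W := by
          intro hzW
          have h1 : z ∈ F ∩ W := mem_inter.2 ⟨hz.1, hzW⟩
          have h2 : z ∈ F' ∩ W := mem_inter.2 ⟨hz.2, hzW⟩
          rw [h.2.2] at h1
          rw [h'.2.2] at h2
          simp only [mem_insert, mem_singleton] at h1 h2
          rcases h1 with rfl | rfl <;> rcases h2 with rfl | rfl <;> tauto
        tauto
      · exact ⟨b, by simp [hW, *]⟩) (by
      rw [Nat.card_Icc] at hS
      omega)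
  rw [card_image_of_injOn hinj] at key
  have hle : #(Icc 1 n \ W) - 1 ≤ n - 3 := by
    -- the four points of W lie in F0 or in another member; only a weak bound is needed
    have h2 : 2 ≤ #(Icc 1 n ∩ W) := by
      rw [← hcard F0 hF0]
      exact card_le_card (inter_subset_inter_right hF0s.1)
    have h1 : #(Icc 1 n \ W) + #(Icc 1 n ∩ W) = #(Icc 1 n) := card_sdiff_add_card_inter _ W
    rw [Nat.card_Icc] at h1
    omega
  rw [show k - 2 - 1 = k - 3 by omega] at key
  unfold c0
  exact_mod_cast key.trans (Nat.choose_le_choose _ hle)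

def hit (a b : ℕ) (F : Finset ℕ) : Prop := a ∈ F ∨ b ∈ F
instance (a b : ℕ) : DecidablePred (hit a b) := fun F => by unfold hit; infer_instance

def PQ (a b c d e f : ℕ) (F : Finset ℕ) : Prop :=
  a ∈ F ∧ b ∈ F ∧ (c ∈ F ∨ d ∈ F) ∧ (e ∈ F ∨ f ∈ F)
instance (a b c d e f : ℕ) : DecidablePred (PQ a b c d e f) := fun F => by
  unfold PQ; infer_instance

def PZ (a b x x' y y' : ℕ) (F : Finset ℕ) : Prop :=
  (a ∈ F ∧ b ∉ F ∧ x ∈ F ∧ x' ∉ F ∧ y ∈ F ∧ y' ∉ F) ∨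
      (a ∉ F ∧ b ∈ F ∧ x ∉ F ∧ x' ∈ F ∧ y ∉ F ∧ y' ∈ F)
instance (a b c d e f : ℕ) : DecidablePred (PZ a b c d e f) := fun F => by
  unfold PZ; infer_instance

theorem cntQ' {n k : ℕ} (hk : 1 ≤ k) (hn : 24 * k ≤ n) {s : Finset (Finset ℕ)} (hs : Uni n k s)
    (a b c d e f : ℕ) (h : [a, b, c, d, e, f].Nodup) :
    (#(s.filter (PQ a b c d e f)) : ℝ) ≤ 4 * (c0 n k * pp n k) :=
  le_trans (cnt_mono (fun _ _ h => h)) (cntQ hk hn hs a b c d e f h)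

theorem cntZ' {n k : ℕ} (hk : 1 ≤ k) (hn : 24 * k ≤ n) {s : Finset (Finset ℕ)} (hs : Uni n k s)
    (hI : Itr s) (a b x x' y y' : ℕ) (h : [a, b, x, x', y, y'].Nodup) :
    (#(s.filter (PZ a b x x' y y')) : ℝ) ≤ c0 n k :=
  le_trans (cnt_mono (fun _ _ h => h)) (cntZ hk hn hs hI a b x x' y y' h)

theorem cntT {n k : ℕ} (hk : 1 ≤ k) (hn : 24 * k ≤ n) {s : Finset (Finset ℕ)} (hs : Uni n k s)
    (hI : Itr s) (a b c d e f : ℕ) (h : [a, b, c, d, e, f].Nodup) :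
    (#(s.filter (fun F => hit a b F ∧ hit c d F ∧ hit e f F)) : ℝ) ≤ 9 / 2 * c0 n k := by
  have q1 := cntQ' hk hn hs a b c d e f h
  have q2 := cntQ' hk hn hs c d a b e f (by grind)
  have q3 := cntQ' hk hn hs e f a b c d (by grind)
  have z1 := cntZ' hk hn hs hI a b c d e f h
  have z2 := cntZ' hk hn hs hI a b c d f e (by grind)
  have z3 := cntZ' hk hn hs hI a b d c e f (by grind)
  have z4 := cntZ' hk hn hs hI a b d c f e (by grind)
  have hp := pp_le hk hn
  have hc := c0_nonneg n k
  have := cnt_or (cnt_or (cnt_or q1 q2) q3) (cnt_or (cnt_or z1 z2) (cnt_or z3 z4))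
  refine le_trans (cnt_mono ?_) (this.trans (by nlinarith))
  intro F _
  unfold hit PQ PZ
  by_cases x1 : a ∈ F <;> by_cases x2 : b ∈ F <;> by_cases x3 : c ∈ F <;>
    by_cases x4 : d ∈ F <;> by_cases x5 : e ∈ F <;> by_cases x6 : f ∈ F <;>
    simp [x1, x2, x3, x4, x5, x6]

theorem no4 {n k : ℕ} (hk : 1 ≤ k) (hn : 24 * k ≤ n) {s : Finset (Finset ℕ)} (hs : Uni n k s)
    (hI : Itr s) (hbig : 36 * c0 n k ≤ #s) (a b c d e f g h : ℕ) (hd : [a, b, c, d, e, f, g, h].Nodup)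
    (ε : ℝ) (hε : ε ≤ 1 / 24)
    (h1 : (2 / 3 - ε) * #s < #(s.filter (hit a b)))
    (h2 : (2 / 3 - ε) * #s < #(s.filter (hit c d)))
    (h3 : (2 / 3 - ε) * #s < #(s.filter (hit e f)))
    (h4 : (2 / 3 - ε) * #s < #(s.filter (hit g h))) : False := by
  have t1 := cntT hk hn hs hI a b c d e f (hd.sublist (by simp))
  have t2 := cntT hk hn hs hI a b c d g h (hd.sublist (by simp))
  have t3 := cntT hk hn hs hI a b e f g h (hd.sublist (by simp))
  have t4 := cntT hk hn hs hI c d e f g h (hd.sublist (by simp))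
  have key : #(s.filter (hit a b)) + #(s.filter (hit c d)) + #(s.filter (hit e f)) +
      #(s.filter (hit g h)) ≤ 2 * #s + (#(s.filter (fun F => hit a b F ∧ hit c d F ∧ hit e f F)) +
      #(s.filter (fun F => hit a b F ∧ hit c d F ∧ hit g h F)) +
      #(s.filter (fun F => hit a b F ∧ hit e f F ∧ hit g h F)) +
      #(s.filter (fun F => hit c d F ∧ hit e f F ∧ hit g h F))) := by
    simp only [card_filter, card_eq_sum_ones s, mul_sum, ← sum_add_distrib]
    apply sum_le_sum
    intro F _
    by_cases x1 : hit a b F <;> by_cases x2 : hit c d F <;> by_cases x3 : hit e f F <;>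
      by_cases x4 : hit g h F <;> simp [x1, x2, x3, x4]
  have key' : (#(s.filter (hit a b)) : ℝ) + #(s.filter (hit c d)) + #(s.filter (hit e f)) +
      #(s.filter (hit g h)) ≤ 2 * #s + (#(s.filter (fun F => hit a b F ∧ hit c d F ∧ hit e f F)) +
      #(s.filter (fun F => hit a b F ∧ hit c d F ∧ hit g h F)) +
      #(s.filter (fun F => hit a b F ∧ hit e f F ∧ hit g h F)) +
      #(s.filter (fun F => hit c d F ∧ hit e f F ∧ hit g h F))) := by exact_mod_cast key
  have : (0 : ℝ) ≤ #s := by positivity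
  nlinarith

end St9

namespace St9

theorem extremis {n k : ℕ} (hk : 1 ≤ k) (hn : 24 * k ≤ n) {s0 : Finset (Finset ℕ)}
    (hs : Uni n k s0) (hI : Itr s0) (hbig : 36 * c0 n k ≤ #s0) (ε : ℝ) (hε : ε ≤ 1 / 24)
    (hdeg : ∀ i ∈ Icc 1 n, (#(s0.filter (fun F => i ∈ F)) : ℝ) ≤ (2 / 3 - ε) * #s0) :
    ∃ s : Finset (Finset ℕ), Uni n k s ∧ Itr s ∧ #s = #s0 ∧
      (∀ i ∈ Icc 1 n, (#(s.filter (fun F => i ∈ F)) : ℝ) ≤ (2 / 3 - ε) * #s) ∧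
      ∃ V ⊆ Icc 1 n, #V ≤ 6 ∧ Stable (Icc 1 n \ V) s := by
  obtain ⟨s, ⟨hU, hI', hc, hd⟩, hmin⟩ := exists_min (fun s => Uni n k s ∧ Itr s ∧ #s = #s0 ∧
      (∀ i ∈ Icc 1 n, (#(s.filter (fun F => i ∈ F)) : ℝ) ≤ (2 / 3 - ε) * #s)) s0
      ⟨hs, hI, rfl, hdeg⟩
  refine ⟨s, hU, hI', hc, hd, ?_⟩
  by_contra! hno
  have step : ∀ V ⊆ Icc 1 n, #V ≤ 6 → ∃ i ∈ Icc 1 n, ∃ j ∈ Icc 1 n, i ∉ V ∧ j ∉ V ∧ i ≠ j ∧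
      (2 / 3 - ε) * #s < #(s.filter (hit i j)) := by
    intro V hV hV6
    have h := hno V hV hV6
    unfold Stable at h
    push Not at h
    obtain ⟨i, hi, j, hj, hij, A, hA, hjA, hiA, hbad⟩ := h
    rw [mem_sdiff] at hi hj
    refine ⟨i, hi.1, j, hj.1, hi.2, hj.2, hij.ne, ?_⟩
    by_contra! hle
    apply hbad
    refine hmin i j hij ⟨uni_sh hi.1 hU, itr_sh hI', by rw [card_sh, hc], ?_⟩ A hA hjA hiA
    intro v hv
    rw [card_sh]
    by_cases h1 : v = i
    · subst h1
      refine le_trans ?_ hle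
      exact_mod_cast (deg_i (i := v) (j := j) (s := s))
    · by_cases h2 : v = j
      · subst h2
        refine le_trans ?_ (hd v hv)
        exact_mod_cast (deg_j (i := i) (j := v) hij.ne (s := s))
      · rw [deg_other h1 h2]; exact hd v hv
  obtain ⟨a, ha, b, hb, -, -, hab, h1⟩ := step ∅ (by simp) (by simp)
  obtain ⟨c, hc', d, hd', hcV, hdV, hcd, h2⟩ := step {a, b} (by intro x; simp only [mem_insert, mem_singleton]; rintro (rfl | rfl) <;> assumption)
    (card_le_two.trans (by omega))
  obtain ⟨e, he, f, hf, heV, hfV, hef, h3⟩ := step {a, b, c, d}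
    (by intro x; simp only [mem_insert, mem_singleton]; rintro (rfl | rfl | rfl | rfl) <;> assumption)
    (card_le_four.trans (by omega))
  obtain ⟨g, hg, h, hh, hgV, hhV, hgh, h4⟩ := step {a, b, c, d, e, f}
    (by intro x; simp only [mem_insert, mem_singleton]
        rintro (rfl | rfl | rfl | rfl | rfl | rfl) <;> assumption)
    card_le_six
  refine no4 hk hn hU hI' (by rw [hc]; exact hbig) a b c d e f g h ?_ ε hε h1 h2 h3 h4
  simp only [mem_insert, mem_singleton] at hcV hdV heV hfV hgV hhV
  grind

end St9

namespace St9

theorem mem_cs {i j x : ℕ} (h1 : x ≠ i) (h2 : x ≠ j) (A : Finset ℕ) : x ∈ cs i j A ↔ x ∈ A := by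
  unfold cs
  split_ifs <;> simp [h1, h2]

theorem lemC_aux {n k : ℕ} (hk : 1 ≤ k) (hn : 24 * k ≤ n) {t : Finset (Finset ℕ)} (hs : Uni n k t)
    (hI : Itr t) (v w u : ℕ) (hwu : w ≠ u) (hS : Stable (Icc 1 n \ {v, w, u}) t)
    (hbig : 18 / 5 * c0 n k < #(t.filter (fun F => v ∉ F ∧ w ∈ F ∧ u ∈ F))) :
    (#(t.filter (fun F => w ∉ F ∧ u ∉ F)) : ℝ) ≤ 96 / 5 * (c0 n k * pp n k) := by
  classical
  set X := Icc 1 n \ {v, w, u} with hX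
  have hG : ∃ G ∈ t, (v ∉ G ∧ w ∈ G ∧ u ∈ G) ∧ ∀ m, #(G ∩ pre X (2 * m + 3)) < m + 1 := by
    by_contra! hno
    have h1 := cnt_union (s := t) (range k) (fun F => v ∉ F ∧ w ∈ F ∧ u ∈ F)
      (fun m F => {w, u} ⊆ F ∧ m + 1 ≤ #(F ∩ pre X (2 * m + 3))) (by
        intro F hF hP
        obtain ⟨m, hm⟩ := hno F hF hP
        refine ⟨m, ?_, by simp [insert_subset_iff, hP], hm⟩
        have := card_le_card (inter_subset_left (s₁ := F) (s₂ := pre X (2 * m + 3)))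
        rw [(hs F hF).2] at this
        rw [mem_range]; omega)
      (fun m => ((2 * m + 3).choose (m + 1) : ℝ) * (c0 n k * pp n k ^ (m + 0))) (by
        intro m _
        have hD : #({w, u} : Finset ℕ) = 2 := card_pair hwu
        have := cntW hk hn hs {w, u} (pre X (2 * m + 3)) (by
          rw [disjoint_left]
          intro x hx hx'
          have := pre_sub X _ hx'
          simp only [hX, mem_sdiff, mem_insert, mem_singleton] at this hx
          tauto) (2 * m + 3) (m + 1) (card_pre _ _) (by omega)
        rwa [hD, show 2 + (m + 1) - 3 = m + 0 by omega] at this)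
    have h2 := series hk hn k 0 3 (fun m => (2 * m + 3).choose (m + 1)) choose_odd'
    simp only [pow_zero, mul_one] at h2
    have := h1.trans h2
    norm_num at this
    linarith
  obtain ⟨G, hGt, hGP, hG⟩ := hG
  have h1 := cnt_union (s := t) (range k) (fun F => w ∉ F ∧ u ∉ F)
      (fun m F => ∅ ⊆ F ∧ m + 4 ≤ #(F ∩ pre X (2 * m + 4))) (by
        intro B hB hP
        by_contra! hno
        have hB' : ∀ m, #(B ∩ pre X (2 * m + 4)) < m + 4 := by
          intro m
          by_cases hm : m < k
          · exact hno m (mem_range.2 hm) (by simp)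
          · have := card_le_card (inter_subset_left (s₁ := B) (s₂ := pre X (2 * m + 4)))
            rw [(hs B hB).2] at this
            omega
        refine no_pair hI hS _ G hGt B hB rfl ?_
        intro y hy
        rw [mem_inter] at hy
        have hyX : y ∈ X := by
          rw [hX, mem_sdiff]
          refine ⟨(hs G hGt).1 hy.1, ?_⟩
          simp only [mem_insert, mem_singleton]
          rintro (rfl | rfl | rfl) <;> tauto
        refine ⟨hyX, ?_⟩
        set z := #(X.filter (· ≤ y)) with hz
        have gl : ∀ z', z ≤ z' → #(G ∩ X.filter (· ≤ y)) ≤ #(G ∩ pre X z') := fun z' h =>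
          card_le_card (inter_subset_inter_left (le_pre X y h))
        have bl : ∀ z', z ≤ z' → #(B ∩ X.filter (· ≤ y)) ≤ #(B ∩ pre X z') := fun z' h =>
          card_le_card (inter_subset_inter_left (le_pre X y h))
        have gpos : 0 < #(G ∩ X.filter (· ≤ y)) :=
          card_pos.2 ⟨y, mem_inter.2 ⟨hy.1, mem_filter.2 ⟨hyX, le_refl _⟩⟩⟩
        have g1 := gl (2 * (z / 2 - 1) + 3) (by omega)
        have g2 := hG (z / 2 - 1)
        have b1 := bl (2 * ((z + 1) / 2 - 2) + 4) (by omega)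
        have b2 := hB' ((z + 1) / 2 - 2)
        omega)
      (fun m => ((2 * m + 4).choose (m + 4) : ℝ) * (c0 n k * pp n k ^ (m + 1))) (by
        intro m _
        have := cntW hk hn hs ∅ (pre X (2 * m + 4)) (by simp) (2 * m + 4) (m + 4) (card_pre _ _)
          (by omega)
        rwa [card_empty, show 0 + (m + 4) - 3 = m + 1 by omega] at this)
  have h2 := series hk hn k 1 16 (fun m => (2 * m + 4).choose (m + 4)) (by
    intro m
    refine (Nat.choose_le_two_pow _ _).trans ?_
    rw [show 2 * m + 4 = 4 + 2 * m by ring, pow_add, pow_mul]; norm_num)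
  refine (h1.trans h2).trans (le_of_eq ?_)
  norm_num

theorem lemC {n k : ℕ} (hk : 1 ≤ k) (hn : 24 * k ≤ n) {s : Finset (Finset ℕ)} (hs : Uni n k s)
    (hI : Itr s) (v w u : ℕ) (hwu : w ≠ u)
    (hbig : 18 / 5 * c0 n k < #(s.filter (fun F => v ∉ F ∧ w ∈ F ∧ u ∈ F))) :
    (#(s.filter (fun F => w ∉ F ∧ u ∉ F)) : ℝ) ≤ 96 / 5 * (c0 n k * pp n k) := by
  obtain ⟨t, ⟨hU, hI', h1, h2⟩, hmin⟩ := exists_min (fun t => Uni n k t ∧ Itr t ∧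
    #(t.filter (fun F => v ∉ F ∧ w ∈ F ∧ u ∈ F)) = #(s.filter (fun F => v ∉ F ∧ w ∈ F ∧ u ∈ F)) ∧
    #(t.filter (fun F => w ∉ F ∧ u ∉ F)) = #(s.filter (fun F => w ∉ F ∧ u ∉ F))) s
    ⟨hs, hI, rfl, rfl⟩
  rw [← h1] at hbig
  rw [← h2]
  refine lemC_aux hk hn hU hI' v w u hwu ?_ hbig
  intro i hi j hj hij
  simp only [mem_sdiff, mem_insert, mem_singleton, not_or] at hi hj
  obtain ⟨hi, a1, a2, a3⟩ := hi
  obtain ⟨hj, b1, b2, b3⟩ := hj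
  refine hmin i j hij ⟨uni_sh hi hU, itr_sh hI', ?_, ?_⟩
  · rw [← h1]
    apply filter_sh
    intro A
    rw [mem_cs (Ne.symm a1) (Ne.symm b1), mem_cs (Ne.symm a2) (Ne.symm b2),
      mem_cs (Ne.symm a3) (Ne.symm b3)]
  · rw [← h2]
    apply filter_sh
    intro A
    rw [mem_cs (Ne.symm a2) (Ne.symm b2), mem_cs (Ne.symm a3) (Ne.symm b3)]

end St9

namespace St9

theorem cnt_hit {g : Finset (Finset ℕ)} (K : Finset ℕ) (q : ℕ) (hK : #K ≤ q)
    (P : Finset ℕ → Prop) [DecidablePred P] (h : ∀ F ∈ g, P F → ∃ x ∈ K, x ∈ F) (β : ℝ) (hβ : 0 ≤ β)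
    (hb : ∀ x ∈ K, (#(g.filter (fun F => P F ∧ x ∈ F)) : ℝ) ≤ β) :
    (#(g.filter P) : ℝ) ≤ q * β := by
  have h1 := cnt_union (s := g) K P (fun x F => P F ∧ x ∈ F) (by
    intro F hF hP
    obtain ⟨x, hx, hxF⟩ := h F hF hP
    exact ⟨x, hx, hP, hxF⟩) (fun _ => β) hb
  rw [sum_const, nsmul_eq_mul] at h1
  have : (#K : ℝ) ≤ q := by exact_mod_cast hK
  nlinarith

theorem cnt3 {n k : ℕ} (hk : 1 ≤ k) (hn : 24 * k ≤ n) {s : Finset (Finset ℕ)} (hs : Uni n k s)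
    (a b c : ℕ) (h1 : a ≠ b) (h2 : a ≠ c) (h3 : b ≠ c) (P : Finset ℕ → Prop) [DecidablePred P]
    (hP : ∀ F, P F → a ∈ F ∧ b ∈ F ∧ c ∈ F) :
    (#(s.filter P) : ℝ) ≤ c0 n k := by
  have hc : #({a, b, c} : Finset ℕ) = 3 := card_eq_three.2 ⟨a, b, c, h1, h2, h3, rfl⟩
  have h := cnt hk hn hs {a, b, c} (by omega)
  rw [hc] at h
  norm_num at h
  refine le_trans (cnt_mono ?_) h
  intro F _ hF
  simp [insert_subset_iff, hP F hF]

/-- number of members with large kernel avoiding `Q` -/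
theorem cntE {n k : ℕ} (hk : 1 ≤ k) (hn : 24 * k ≤ n) {g : Finset (Finset ℕ)} (hs : Uni n k g)
    (U Q : Finset ℕ) (m : ℕ) (hm : 8 ≤ m) (hU : #(U \ Q) ≤ m)
    (hg : ∀ F ∈ g, ∀ F' ∈ g, ((F ∩ U) ∩ (F' ∩ U)).Nonempty) :
    (#(g.filter (fun F => (∀ x ∈ Q, x ∉ F) ∧ 4 ≤ #(F ∩ U))) : ℝ) ≤
      (m - 1).choose 3 * (c0 n k * pp n k) + m.choose 5 * (c0 n k * pp n k ^ 2) := by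
  have hsub : ∀ F : Finset ℕ, (∀ x ∈ Q, x ∉ F) → F ∩ U ⊆ U \ Q := by
    intro F hF x hx
    rw [mem_inter] at hx
    rw [mem_sdiff]
    exact ⟨hx.2, fun h => hF x h hx.1⟩
  have h5 := cntW hk hn hs ∅ (U \ Q) (by simp) m 5 hU (by omega)
  rw [card_empty] at h5
  obtain ⟨T, hUT, hT⟩ := Infinite.exists_superset_card_eq (U \ Q) m hU
  set K := (g.filter (fun F => (∀ x ∈ Q, x ∉ F) ∧ #(F ∩ U) = 4)).image (fun F => F ∩ U) with hK
  have hKc := ekr T 4 K (by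
    intro A hA
    obtain ⟨F, hF, rfl⟩ := mem_image.1 hA
    rw [mem_filter] at hF
    exact ⟨(hsub F hF.2.1).trans hUT, hF.2.2⟩) (by
    intro A hA B hB
    obtain ⟨F, hF, rfl⟩ := mem_image.1 hA
    obtain ⟨F', hF', rfl⟩ := mem_image.1 hB
    exact hg F (mem_filter.1 hF).1 F' (mem_filter.1 hF').1) (by omega)
  rw [hT] at hKc
  have h4 := cnt_union (s := g) K (fun F => (∀ x ∈ Q, x ∉ F) ∧ #(F ∩ U) = 4) (fun S F => S ⊆ F) (by
    intro F hF hP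
    exact ⟨F ∩ U, mem_image.2 ⟨F, mem_filter.2 ⟨hF, hP⟩, rfl⟩, inter_subset_left⟩)
    (fun _ => c0 n k * pp n k) (by
    intro A hA
    obtain ⟨F, hF, rfl⟩ := mem_image.1 hA
    have hc := (mem_filter.1 hF).2.2
    have := cnt hk hn hs (F ∩ U) (by omega)
    rw [hc] at this
    simpa using this)
  rw [sum_const, nsmul_eq_mul] at h4
  have h4' : (#(g.filter (fun F => (∀ x ∈ Q, x ∉ F) ∧ #(F ∩ U) = 4)) : ℝ) ≤
      (m - 1).choose 3 * (c0 n k * pp n k) := by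
    refine h4.trans (mul_le_mul_of_nonneg_right (by exact_mod_cast hKc)
      (mul_nonneg (c0_nonneg n k) (pp_nonneg n k)))
  refine le_trans (cnt_mono ?_) (cnt_or h4' h5)
  rintro F _ ⟨h1, h2⟩
  rcases Nat.eq_or_lt_of_le h2 with h | h
  · exact Or.inl ⟨h1, h.symm⟩
  · refine Or.inr ⟨by simp, le_trans (Nat.succ_le_of_lt h) (card_le_card ?_)⟩
    exact subset_inter inter_subset_left (hsub F h1)

theorem kernel {n k : ℕ} (hk : 1 ≤ k) (hn : 24 * k ≤ n) {g : Finset (Finset ℕ)} (hs : Uni n k g)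
    (hc0 : 0 < c0 n k) (U : Finset ℕ) (hU : #U ≤ 12)
    (hg : ∀ F ∈ g, ∀ F' ∈ g, ((F ∩ U) ∩ (F' ∩ U)).Nonempty)
    (hbig : 137 / 4 * c0 n k ≤ #g)
    (hdeg : ∀ v, 41 / 4 * c0 n k ≤ #(g.filter (fun F => v ∉ F))) :
    ∃ a b u, a ≠ b ∧ a ≠ u ∧ b ≠ u ∧ (#(g.filter (fun F => a ∉ F ∧ b ∉ F)) : ℝ) ≤ 63 / 16 * c0 n k ∧
      18 / 5 * c0 n k < #(g.filter (fun F => a ∉ F ∧ b ∈ F ∧ u ∈ F)) := by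
  classical
  have hp := pp_le hk hn
  have hp0 := pp_nonneg n k
  have e12 := cntE hk hn hs U ∅ 12 (by omega) (by simpa using hU) hg
  have e11 := fun a (ha : a ∈ U) => cntE hk hn hs U {a} 11 (by omega) (by
    rw [sdiff_singleton_eq_erase, card_erase_of_mem ha]; omega) hg
  have e10 := fun a (ha : a ∈ U) b (hb : b ∈ U) (hab : a ≠ b) =>
    cntE hk hn hs U {a, b} 10 (by omega) (by
      rw [card_sdiff_of_subset (by simp [insert_subset_iff, ha, hb]), card_pair hab]; omega) hg
  have hp2 : c0 n k * pp n k ^ 2 ≤ c0 n k * (1 / 576) := by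
    apply mul_le_mul_of_nonneg_left _ hc0.le
    nlinarith
  have hp1 : c0 n k * pp n k ≤ c0 n k * (1 / 24) := mul_le_mul_of_nonneg_left hp hc0.le
  norm_num [Nat.choose] at e12 e11 e10
  -- small members
  have s1 : ∃ F ∈ g, #(F ∩ U) ≤ 3 := by
    by_contra! hno
    have : (#g : ℝ) ≤ #(g.filter (fun F => 4 ≤ #(F ∩ U))) := by
      rw [filter_true_of_mem (fun F hF => Nat.succ_le_of_lt (hno F hF))]
    linarith
  have s2 : ∀ a ∈ U, ∃ F ∈ g, #(F ∩ U) ≤ 3 ∧ a ∉ F := by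
    intro a ha
    by_contra! hno
    have : (#(g.filter (fun F => a ∉ F)) : ℝ) ≤ #(g.filter (fun F => a ∉ F ∧ 4 ≤ #(F ∩ U))) := by
      apply cnt_mono
      intro F hF hP
      refine ⟨hP, ?_⟩
      by_contra hlt
      exact hP (hno F hF (by omega))
    have h1 := e11 a ha
    have h2 := hdeg a
    linarith
  have hmeet : ∀ F ∈ g, ∀ F' ∈ g, ∃ x ∈ F ∩ U, x ∈ F' := by
    intro F hF F' hF'
    obtain ⟨x, hx⟩ := hg F hF F' hF'
    rw [mem_inter, mem_inter, mem_inter] at hx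
    exact ⟨x, mem_inter.2 hx.1, hx.2.1⟩
  -- a pair hitting all small members
  have s3 : ∃ a ∈ U, ∃ b ∈ U, a ≠ b ∧ ∀ F ∈ g, #(F ∩ U) ≤ 3 → a ∉ F → b ∈ F := by
    by_contra! hno
    obtain ⟨F1, hF1, hF1c⟩ := s1
    have := cnt_hit (g := g) (F1 ∩ U) 3 hF1c (fun _ => True)
      (fun F hF _ => hmeet F1 hF1 F hF) (9 * c0 n k) (by positivity) (by
      intro a ha
      obtain ⟨F2, hF2, hF2c, haF2⟩ := s2 a (mem_inter.1 ha).2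
      have := cnt_hit (g := g) (F2 ∩ U) 3 hF2c (fun F => True ∧ a ∈ F)
        (fun F hF _ => hmeet F2 hF2 F hF) (3 * c0 n k) (by positivity) (by
        intro b hb
        rw [mem_inter] at hb
        have hab : a ≠ b := by rintro rfl; exact haF2 hb.1
        obtain ⟨F3, hF3, hF3c, haF3, hbF3⟩ := hno a (mem_inter.1 ha).2 b hb.2 hab
        have := cnt_hit (g := g) (F3 ∩ U) 3 hF3c (fun F => (True ∧ a ∈ F) ∧ b ∈ F)
          (fun F hF _ => hmeet F3 hF3 F hF) (c0 n k) (by positivity) (by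
          intro c hc
          rw [mem_inter] at hc
          refine cnt3 hk hn hs a b c hab ?_ ?_ _ (fun F hF => by tauto)
          · rintro rfl; exact haF3 hc.1
          · rintro rfl; exact hbF3 hc.1)
        push_cast at this
        linarith)
      push_cast at this
      linarith)
    rw [filter_true] at this
    push_cast at this
    linarith
  obtain ⟨a, ha, b, hb, hab, hhit⟩ := s3
  have hnone : (#(g.filter (fun F => a ∉ F ∧ b ∉ F)) : ℝ) ≤ 63 / 16 * c0 n k := by
    have h1 := e10 a ha b hb hab
    have h2 : (#(g.filter (fun F => a ∉ F ∧ b ∉ F)) : ℝ) ≤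
        #(g.filter (fun F => (a ∉ F ∧ b ∉ F) ∧ 4 ≤ #(F ∩ U))) := by
      apply cnt_mono
      rintro F hF ⟨h1, h2⟩
      refine ⟨⟨h1, h2⟩, ?_⟩
      by_contra hlt
      exact h2 (hhit F hF (by omega) h1)
    linarith
  have hGa : 101 / 16 * c0 n k ≤ #(g.filter (fun F => a ∈ F ∧ b ∉ F)) := by
    have h1 : (#(g.filter (fun F => b ∉ F)) : ℝ) ≤
        #(g.filter (fun F => (a ∈ F ∧ b ∉ F) ∨ (a ∉ F ∧ b ∉ F))) := by
      apply cnt_mono; intro F _; tauto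
    have h2 := cnt_or (s := g) (P := fun F => a ∈ F ∧ b ∉ F) (Q := fun F => a ∉ F ∧ b ∉ F)
      (le_refl _) hnone
    have h3 := hdeg b
    linarith
  have s4 : ∃ u ∈ U, u ≠ b ∧ ∀ F ∈ g, #(F ∩ U) ≤ 3 → a ∉ F → u ∈ F := by
    by_contra! hno
    have hK : ∀ F ∈ g, #(F ∩ U) ≤ 3 → a ∉ F → #((F ∩ U).erase b) ≤ 2 := by
      intro F hF hFc haF
      rw [card_erase_of_mem (mem_inter.2 ⟨hhit F hF hFc haF, hb⟩)]
      omega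
    have hm : ∀ F ∈ g, ∀ F' ∈ g, b ∉ F' → ∃ x ∈ (F ∩ U).erase b, x ∈ F' := by
      intro F hF F' hF' hbF'
      obtain ⟨x, hx, hx'⟩ := hmeet F hF F' hF'
      refine ⟨x, mem_erase.2 ⟨?_, hx⟩, hx'⟩
      rintro rfl; exact hbF' hx'
    obtain ⟨F1, hF1, hF1c, haF1⟩ := s2 a ha
    have := cnt_hit (g := g) ((F1 ∩ U).erase b) 2 (hK F1 hF1 hF1c haF1) (fun F => a ∈ F ∧ b ∉ F)
      (fun F hF hP => hm F1 hF1 F hF hP.2) (2 * c0 n k) (by positivity) (by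
      intro x hx
      rw [mem_erase, mem_inter] at hx
      obtain ⟨F2, hF2, hF2c, haF2, hxF2⟩ := hno x hx.2.2 hx.1
      have := cnt_hit (g := g) ((F2 ∩ U).erase b) 2 (hK F2 hF2 hF2c haF2)
        (fun F => (a ∈ F ∧ b ∉ F) ∧ x ∈ F)
        (fun F hF hP => hm F2 hF2 F hF hP.1.2) (c0 n k) (by positivity) (by
        intro y hy
        rw [mem_erase, mem_inter] at hy
        refine cnt3 hk hn hs a x y ?_ ?_ ?_ _ (fun F hF => by tauto)
        · rintro rfl; exact haF1 hx.2.1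
        · rintro rfl; exact haF2 hy.2.1
        · rintro rfl; exact hxF2 hy.2.1)
      push_cast at this
      linarith)
    push_cast at this
    linarith
  obtain ⟨u, hu, hub, huall⟩ := s4
  refine ⟨a, b, u, hab, ?_, hub.symm, hnone, ?_⟩
  · rintro rfl
    obtain ⟨F1, hF1, hF1c, haF1⟩ := s2 a ha
    exact haF1 (huall F1 hF1 hF1c haF1)
  · have h1 : (#(g.filter (fun F => a ∉ F)) : ℝ) ≤
        #(g.filter (fun F => (a ∉ F ∧ b ∈ F ∧ u ∈ F) ∨ (a ∉ F ∧ 4 ≤ #(F ∩ U)))) := by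
      apply cnt_mono
      intro F hF haF
      by_cases hc : 4 ≤ #(F ∩ U)
      · exact Or.inr ⟨haF, hc⟩
      · exact Or.inl ⟨haF, hhit F hF (by omega) haF, huall F hF (by omega) haF⟩
    have h2 := cnt_or (s := g) (P := fun F => a ∉ F ∧ b ∈ F ∧ u ∈ F) (Q := fun F => a ∉ F ∧ 4 ≤ #(F ∩ U))
      (le_refl _) (e11 a ha)
    have h3 := hdeg a
    linarith

end St9

namespace St9

theorem filter_not_card {s : Finset (Finset ℕ)} (P : Finset ℕ → Prop) [DecidablePred P] :
    (#(s.filter P) : ℝ) + #(s.filter (fun F => ¬ P F)) = #s := by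
  exact_mod_cast card_filter_add_card_filter_not (s := s) P

theorem triangle {n k : ℕ} (hk : 1 ≤ k) (hn : 24 * k ≤ n) {s : Finset (Finset ℕ)} (hs : Uni n k s)
    (hI : Itr s) (hbig : 36 * c0 n k ≤ #s) (hc0 : 0 < c0 n k) (V : Finset ℕ)
    (hV6 : #V ≤ 6) (hS : Stable (Icc 1 n \ V) s)
    (hdeg : ∀ v, 12 * c0 n k ≤ #(s.filter (fun F => v ∉ F))) :
    ∃ a b u, a ≠ b ∧ a ≠ u ∧ b ≠ u ∧ (#(s.filter (fun F => a ∉ F ∧ b ∉ F)) : ℝ) ≤ 91 / 16 * c0 n k ∧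
      18 / 5 * c0 n k < #(s.filter (fun F => a ∉ F ∧ b ∈ F ∧ u ∈ F)) := by
  classical
  set X := Icc 1 n \ V with hX
  set good : Finset ℕ → Prop := fun F => ∀ m ∈ range k, #(F ∩ pre X (2 * m + 7)) < m + 4 with hgood
  have hp := pp_le hk hn
  have hbad : (#(s.filter (fun F => ¬ good F)) : ℝ) ≤ 7 / 4 * c0 n k := by
    have h1 := cnt_union (s := s) (range k) (fun F => ¬ good F)
      (fun m F => ∅ ⊆ F ∧ m + 4 ≤ #(F ∩ pre X (2 * m + 7))) (by
        intro F _ hF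
        simp only [hgood] at hF
        push Not at hF
        obtain ⟨m, hm, h⟩ := hF
        exact ⟨m, hm, by simp, h⟩)
      (fun m => ((2 * m + 7).choose (m + 4) : ℝ) * (c0 n k * pp n k ^ (m + 1))) (by
        intro m _
        have := cntW hk hn hs ∅ (pre X (2 * m + 7)) (by simp) (2 * m + 7) (m + 4) (card_pre _ _)
          (by omega)
        rwa [card_empty, show 0 + (m + 4) - 3 = m + 1 by omega] at this)
    have h2 := series hk hn k 1 35 (fun m => (2 * m + 7).choose (m + 4)) choose_odd
    have h3 := h1.trans h2
    push_cast at h3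
    rw [pow_one] at h3
    nlinarith
  have hsub : s.filter good ⊆ s := filter_subset _ _
  have hsplit : ∀ (P : Finset ℕ → Prop) [DecidablePred P], (#(s.filter P) : ℝ) - 7 / 4 * c0 n k ≤
      #((s.filter good).filter P) := by
    intro P _
    have h1 : (#(s.filter P) : ℝ) ≤ #(s.filter (fun F => (good F ∧ P F) ∨ ¬ good F)) := by
      apply cnt_mono; intro F _ _; tauto
    have h2 := cnt_or (s := s) (P := fun F => good F ∧ P F) (Q := fun F => ¬ good F) (le_refl _) hbad
    rw [filter_filter]
    linarith
  obtain ⟨a, b, u, h1, h2, h3, hnone, h4⟩ := kernel (g := s.filter good) hk hn (fun F hF => hs F (hsub hF)) hc0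
    (V ∪ pre X 6) (by
      have h1 := card_union_le V (pre X 6)
      have h2 := card_pre X 6
      omega) (by
      intro F hF F' hF'
      rw [mem_filter] at hF hF'
      by_contra hemp
      have hgd : ∀ F ∈ s, good F → ∀ m, #(F ∩ pre X (2 * m + 7)) < m + 4 := by
        intro F hF hg m
        by_cases hm : m < k
        · exact hg m (mem_range.2 hm)
        · have := card_le_card (inter_subset_left (s₁ := F) (s₂ := pre X (2 * m + 7)))
          rw [(hs F hF).2] at this
          omega
      refine no_pair hI hS _ F hF.1 F' hF'.1 rfl ?_
      intro y hy
      rw [mem_inter] at hy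
      have hyU : y ∉ V ∪ pre X 6 := by
        intro h
        exact hemp ⟨y, by simp only [mem_inter]; exact ⟨⟨hy.1, h⟩, hy.2, h⟩⟩
      rw [mem_union, not_or] at hyU
      have hyX : y ∈ X := by
        rw [hX, mem_sdiff]
        exact ⟨(hs F hF.1).1 hy.1, hyU.1⟩
      refine ⟨hyX, ?_⟩
      have hz7 : 6 < #(X.filter (· ≤ y)) := by
        by_contra hle
        exact hyU.2 (mem_filter.2 ⟨hyX, not_lt.1 hle⟩)
      set z := #(X.filter (· ≤ y)) with hz
      have gl : ∀ G : Finset ℕ, #(G ∩ X.filter (· ≤ y)) ≤ #(G ∩ pre X (2 * ((z - 6) / 2) + 7)) :=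
        fun G => card_le_card (inter_subset_inter_left (le_pre X y (by omega)))
      have a1 := gl F
      have a2 := gl F'
      have a3 := hgd F hF.1 hF.2 ((z - 6) / 2)
      have a4 := hgd F' hF'.1 hF'.2 ((z - 6) / 2)
      omega) (by
      have := hsplit (fun _ => True)
      rw [filter_true, filter_true] at this
      linarith) (by
      intro v
      have h1 := hsplit (fun F => v ∉ F)
      have h2 := hdeg v
      linarith)
  refine ⟨a, b, u, h1, h2, h3, ?_, h4.trans_le ?_⟩
  · have := hsplit (fun F => a ∉ F ∧ b ∉ F)
    linarith
  exact_mod_cast card_le_card (filter_subset_filter _ hsub)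

theorem final {n k : ℕ} (hk : 1 ≤ k) (hn : 24 * k ≤ n) {s : Finset (Finset ℕ)} (hs : Uni n k s)
    (hI : Itr s) (hbig : 36 * c0 n k ≤ #s) (hc0 : 0 < c0 n k) (V : Finset ℕ)
    (hV6 : #V ≤ 6) (hS : Stable (Icc 1 n \ V) s) (ε : ℝ) (hε0 : 0 < ε) (hpε : pp n k ≤ ε)
    (hdeg : ∀ i ∈ Icc 1 n, (#(s.filter (fun F => i ∈ F)) : ℝ) ≤ (2 / 3 - ε) * #s) : False := by
  have hp := pp_le hk hn
  have hmiss : ∀ v, 12 * c0 n k ≤ #(s.filter (fun F => v ∉ F)) := by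
    intro v
    have h0 := filter_not_card (s := s) (fun F => v ∈ F)
    by_cases hv : v ∈ Icc 1 n
    · have h1 := hdeg v hv
      nlinarith
    · have : s.filter (fun F => v ∉ F) = s := by
        apply filter_true_of_mem
        intro F hF hvF
        exact hv ((hs F hF).1 hvF)
      rw [this]; linarith
  obtain ⟨a, b, u, hab, hau, hbu, hnone, h1⟩ := triangle hk hn hs hI hbig hc0 V hV6 hS hmiss
  have hcp : c0 n k * pp n k ≤ c0 n k * (1 / 24) := mul_le_mul_of_nonneg_left hp hc0.le
  have L1 := lemC hk hn hs hI a b u hbu h1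
  have h2 : 18 / 5 * c0 n k < #(s.filter (fun F => b ∉ F ∧ a ∈ F ∧ u ∈ F)) := by
    have q := cnt_or (cnt_or (le_refl (#(s.filter (fun F => b ∉ F ∧ a ∈ F ∧ u ∈ F)) : ℝ)) hnone) L1
    have q2 : (#(s.filter (fun F => b ∉ F)) : ℝ) ≤ #(s.filter (fun F =>
        ((b ∉ F ∧ a ∈ F ∧ u ∈ F) ∨ (a ∉ F ∧ b ∉ F)) ∨ (b ∉ F ∧ u ∉ F))) := by
      apply cnt_mono; intro F _; tauto
    have q3 := hmiss b
    linarith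
  have L2 := lemC hk hn hs hI b a u hau h2
  have h3 : 18 / 5 * c0 n k < #(s.filter (fun F => u ∉ F ∧ a ∈ F ∧ b ∈ F)) := by
    have q := cnt_or (cnt_or (le_refl (#(s.filter (fun F => u ∉ F ∧ a ∈ F ∧ b ∈ F)) : ℝ)) L1) L2
    have q2 : (#(s.filter (fun F => u ∉ F)) : ℝ) ≤ #(s.filter (fun F =>
        ((u ∉ F ∧ a ∈ F ∧ b ∈ F) ∨ (b ∉ F ∧ u ∉ F)) ∨ (a ∉ F ∧ u ∉ F))) := by
      apply cnt_mono; intro F _; tauto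
    have q3 := hmiss u
    linarith
  have L3 := lemC hk hn hs hI u a b hab h3
  have hmem : ∀ P : Finset ℕ → Prop, ∀ [DecidablePred P], 18 / 5 * c0 n k < #(s.filter P) →
      ∃ F ∈ s, P F := by
    intro P _ h
    have hpos : (0 : ℝ) < #(s.filter P) := by linarith
    obtain ⟨F, hF⟩ := card_pos.1 (by exact_mod_cast hpos : 0 < #(s.filter P))
    exact ⟨F, (mem_filter.1 hF).1, (mem_filter.1 hF).2⟩
  obtain ⟨F1, hF1, -, hb1, hu1⟩ := hmem _ h1
  obtain ⟨F2, hF2, -, ha2, -⟩ := hmem _ h2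
  have da := hdeg a ((hs F2 hF2).1 ha2)
  have db := hdeg b ((hs F1 hF1).1 hb1)
  have du := hdeg u ((hs F1 hF1).1 hu1)
  have key : 2 * #s ≤ #(s.filter (fun F => a ∈ F)) + #(s.filter (fun F => b ∈ F)) +
      #(s.filter (fun F => u ∈ F)) + (#(s.filter (fun F => b ∉ F ∧ u ∉ F)) +
      #(s.filter (fun F => a ∉ F ∧ u ∉ F)) + #(s.filter (fun F => a ∉ F ∧ b ∉ F))) := by
    simp only [card_filter, card_eq_sum_ones s, mul_sum, ← sum_add_distrib]
    apply sum_le_sum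
    intro F _
    by_cases x1 : a ∈ F <;> by_cases x2 : b ∈ F <;> by_cases x3 : u ∈ F <;> simp [x1, x2, x3]
  have key' : 2 * (#s : ℝ) ≤ #(s.filter (fun F => a ∈ F)) + #(s.filter (fun F => b ∈ F)) +
      #(s.filter (fun F => u ∈ F)) + (#(s.filter (fun F => b ∉ F ∧ u ∉ F)) +
      #(s.filter (fun F => a ∉ F ∧ u ∉ F)) + #(s.filter (fun F => a ∉ F ∧ b ∉ F))) := by
    exact_mod_cast key
  have e1 : ε * (36 * c0 n k) ≤ ε * #s := mul_le_mul_of_nonneg_left hbig hε0.le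
  have e2 : c0 n k * pp n k ≤ c0 n k * ε := mul_le_mul_of_nonneg_left hpε hc0.le
  have e3 : 0 < c0 n k * ε := mul_pos hc0 hε0
  nlinarith

end St9

end

theorem stmt_9 (n k : ℕ) (ε : ℝ) (hε0 : 0 < ε) (hε1 : ε ≤ 1 / 24)
    (hn : (k : ℝ) / ε ≤ (n : ℝ)) (𝓕 : Finset (Finset ℕ))
    (h𝓕 : ∀ F ∈ 𝓕, F ⊆ Finset.Icc 1 n ∧ F.card = k)
    (hint : ∀ F ∈ 𝓕, ∀ F' ∈ 𝓕, (F ∩ F').Nonempty)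
    (hbig : 36 * (n - 3).choose (k - 3) ≤ 𝓕.card) :
    ∃ i ∈ Finset.Icc 1 n,
      (2 / 3 - ε) * (𝓕.card : ℝ) < ((𝓕.filter (fun F => i ∈ F)).card : ℝ) := by
  by_contra! hdeg
  have hkn : (k : ℝ) ≤ ε * n := by
    rw [div_le_iff₀ hε0] at hn; linarith
  have hn24 : 24 * k ≤ n := by
    have h0 : (0 : ℝ) ≤ n := Nat.cast_nonneg n
    have h : (24 : ℝ) * k ≤ n := by nlinarith
    exact_mod_cast h
  have hcpos : 0 < (n - 3).choose (k - 3) := Nat.choose_pos (by omega)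
  have hk : 1 ≤ k := by
    obtain ⟨F, hF⟩ := Finset.card_pos.1 (show 0 < 𝓕.card by omega)
    obtain ⟨x, hx⟩ := hint F hF F hF
    rw [Finset.inter_self] at hx
    rw [← (h𝓕 F hF).2]
    exact Finset.card_pos.2 ⟨x, hx⟩
  have hc0 : 0 < St9.c0 n k := by unfold St9.c0; exact_mod_cast hcpos
  have hb : 36 * St9.c0 n k ≤ (𝓕.card : ℝ) := by unfold St9.c0; exact_mod_cast hbig
  obtain ⟨s, hU, hI, hc, hd, V, -, hV6, hS⟩ := St9.extremis hk hn24 h𝓕 hint hb ε hε1 hdeg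
  have hpε : St9.pp n k ≤ ε := by
    unfold St9.pp
    have hn0 : (0 : ℝ) < n := by
      have : 0 < n := by omega
      exact_mod_cast this
    rw [div_le_iff₀ hn0]; exact hkn
  exact St9.final hk hn24 hU hI (by rw [hc]; exact hb) hc0 V hV6 hS ε hε0 hpε hd
end

section
/- Let F ⊂ binom([n], k) be intersecting with n > 2k ≥ 6 and diversity γ(F) ≥ r. If 1 ≤ r ≤ k − 2, then |F| ≤ C(n−1, k−1) − C(n−k, k−1) + C(n−k−r, k−r−1) + r. If k − 1 ≤ r ≤ n − k, then |F| ≤ C(n−1, k−1) − C(n−k, k−1) + n − k. -/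
namespace DivBound

open Finset

def Unif (U : Finset ℕ) (k : ℕ) (G : Finset (Finset ℕ)) : Prop :=
  ∀ F ∈ G, F ⊆ U ∧ F.card = k

def Cross (G H : Finset (Finset ℕ)) : Prop :=
  ∀ A ∈ G, ∀ B ∈ H, (A ∩ B).Nonempty

def Shifted (U : Finset ℕ) (G : Finset (Finset ℕ)) : Prop :=
  ∀ F ∈ G, ∀ i ∈ U, ∀ j ∈ F, i ∉ F → i < j → insert i (F.erase j) ∈ G

lemma Cross.symm {G H : Finset (Finset ℕ)} (h : Cross G H) : Cross H G := by
  intro A hA B hB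
  rw [inter_comm]
  exact h B hB A hA

lemma unif_non {U : Finset ℕ} {k m : ℕ} {G : Finset (Finset ℕ)} (h : Unif U k G) :
    Unif (U.erase m) k (G.nonMemberSubfamily m) := by
  intro F hF
  rw [mem_nonMemberSubfamily] at hF
  exact ⟨subset_erase.2 ⟨(h F hF.1).1, hF.2⟩, (h F hF.1).2⟩

lemma unif_mem {U : Finset ℕ} {k m : ℕ} {G : Finset (Finset ℕ)} (h : Unif U (k + 1) G) :
    Unif (U.erase m) k (G.memberSubfamily m) := by
  intro F hF
  rw [mem_memberSubfamily] at hF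
  have h1 := h _ hF.1
  rw [card_insert_of_notMem hF.2] at h1
  exact ⟨subset_erase.2 ⟨(subset_insert _ _).trans h1.1, hF.2⟩, by omega⟩

lemma shifted_non {U : Finset ℕ} {m : ℕ} {G : Finset (Finset ℕ)} (h : Shifted U G) :
    Shifted (U.erase m) (G.nonMemberSubfamily m) := by
  intro F hF i hi j hj hiF hij
  rw [mem_nonMemberSubfamily] at hF ⊢
  refine ⟨h F hF.1 i (mem_of_mem_erase hi) j hj hiF hij, ?_⟩
  have := ne_of_mem_erase hi
  simp only [mem_insert, mem_erase, not_or, not_and]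
  exact ⟨fun h => this h.symm, fun _ => hF.2⟩

lemma shifted_mem {U : Finset ℕ} {m : ℕ} {G : Finset (Finset ℕ)} (h : Shifted U G) :
    Shifted (U.erase m) (G.memberSubfamily m) := by
  intro F hF i hi j hj hiF hij
  rw [mem_memberSubfamily] at hF ⊢
  have him := ne_of_mem_erase hi
  have hjm : j ≠ m := by rintro rfl; exact hF.2 hj
  have := h _ hF.1 i (mem_of_mem_erase hi) j (mem_insert_of_mem hj)
    (by simp [him, hiF]) hij
  rw [erase_insert_of_ne hjm.symm, Finset.insert_comm] at this
  refine ⟨this, ?_⟩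
  simp only [mem_insert, mem_erase, not_or, not_and]
  exact ⟨fun h => him h.symm, fun _ => hF.2⟩

lemma card_split (G : Finset (Finset ℕ)) (m : ℕ) :
    (G.memberSubfamily m).card + (G.nonMemberSubfamily m).card = G.card :=
  card_memberSubfamily_add_card_nonMemberSubfamily m G

lemma cross_non {m : ℕ} {G H : Finset (Finset ℕ)} (h : Cross G H) :
    Cross (G.nonMemberSubfamily m) (H.nonMemberSubfamily m) := by
  intro A hA B hB
  rw [mem_nonMemberSubfamily] at hA hB
  exact h A hA.1 B hB.1

lemma cross_non_mem {m : ℕ} {G H : Finset (Finset ℕ)} (h : Cross G H) :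
    Cross (G.nonMemberSubfamily m) (H.memberSubfamily m) := by
  intro A hA B hB
  rw [mem_nonMemberSubfamily] at hA
  rw [mem_memberSubfamily] at hB
  obtain ⟨x, hx⟩ := h A hA.1 _ hB.1
  rw [mem_inter, mem_insert] at hx
  refine ⟨x, mem_inter.2 ⟨hx.1, ?_⟩⟩
  rcases hx.2 with rfl | h
  · exact absurd hx.1 hA.2
  · exact h

lemma cross_mem {U : Finset ℕ} {a m : ℕ} {G H : Finset (Finset ℕ)} (h : Cross G H)
    (hG : Unif U (a + 1) G) (hH : Unif U (a + 1) H) (hU : 2 * (a + 1) ≤ U.card)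
    (hm : ∀ x ∈ U, x ≤ m) (hs : Shifted U G) :
    Cross (G.memberSubfamily m) (H.memberSubfamily m) := by
  intro A hA B hB
  have hA' := unif_mem (m := m) hG A hA
  have hB' := unif_mem (m := m) hH B hB
  rw [mem_memberSubfamily] at hA hB
  by_contra hne
  rw [not_nonempty_iff_eq_empty] at hne
  have hc : (insert m (A ∪ B)).card < U.card := by
    have := card_insert_le m (A ∪ B)
    have := card_union_le A B
    omega
  obtain ⟨x, hxU, hx⟩ := exists_mem_notMem_of_card_lt_card hc
  simp only [mem_insert, mem_union, not_or] at hx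
  have h1 := hs _ hA.1 x hxU m (mem_insert_self _ _) (by simp [hx.1, hx.2.1])
    (lt_of_le_of_ne (hm x hxU) hx.1)
  rw [erase_insert hA.2] at h1
  obtain ⟨y, hy⟩ := h _ h1 _ hB.1
  simp only [mem_inter, mem_insert] at hy
  rcases hy with ⟨rfl | hyA, rfl | hyB⟩
  · exact hx.1 rfl
  · exact hx.2.2 hyB
  · exact hA.2 hyA
  · have : y ∈ A ∩ B := mem_inter.2 ⟨hyA, hyB⟩
    rw [hne] at this
    simp at this

/-- Many sets avoiding the top element. -/
lemma top_count {W T : Finset ℕ} {m : ℕ} {K : Finset (Finset ℕ)} (hWT : Disjoint W T)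
    (h : ∀ x ∈ W, insert x (T.erase m) ∈ K) : W.card ≤ K.card := by
  apply card_le_card_of_injOn (fun x => insert x (T.erase m)) h
  intro x hx y hy hxy
  have h1 : x ∈ insert y (T.erase m) := by
    have : x ∈ insert x (T.erase m) := mem_insert_self _ _
    simpa only [hxy] using this
  rcases mem_insert.1 h1 with h | h
  · exact h
  · exact absurd (mem_of_mem_erase h) (disjoint_left.1 hWT hx)

lemma base_cross {U : Finset ℕ} {a : ℕ} {G H : Finset (Finset ℕ)} (h : Cross G H)
    (hG : Unif U a G) (hH : Unif U a H) (hU : U.card = 2 * a) :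
    G.card + H.card ≤ (2 * a).choose a := by
  have hH' : (H.image (fun B => U \ B)).card = H.card := by
    apply card_image_of_injOn
    intro x hx y hy hxy
    have h1 : U \ (U \ x) = U \ (U \ y) := by
      simp only at hxy
      rw [hxy]
    rwa [Finset.sdiff_sdiff_eq_self (hH x hx).1, Finset.sdiff_sdiff_eq_self (hH y hy).1] at h1
  rw [← hH', ← card_union_of_disjoint, ← hU, ← card_powersetCard]
  · apply card_le_card
    intro F hF
    rw [mem_powersetCard]
    rcases mem_union.1 hF with hF | hF
    · exact hG F hF
    · obtain ⟨B, hB, rfl⟩ := mem_image.1 hF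
      refine ⟨sdiff_subset, ?_⟩
      rw [card_sdiff_of_subset (hH B hB).1, (hH B hB).2]
      omega
  · rw [disjoint_left]
    intro F hF hF'
    obtain ⟨B, hB, rfl⟩ := mem_image.1 hF'
    obtain ⟨x, hx⟩ := h _ hF B hB
    simp at hx

/-- Number of `a`-sets disjoint from one of `r` given `b`-sets. -/
lemma count_aux {U : Finset ℕ} {a b p : ℕ} (hU : U.card = b + p) (B : Finset (Finset ℕ)) :
    Unif U b B → B.card ≤ a → B.card ≤ p + 1 →
    (p + 1).choose a ≤ ((powersetCard a U).filter (fun S => ∃ T ∈ B, Disjoint S T)).card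
      + (p + 1 - B.card).choose (a - B.card) := by
  induction B using Finset.induction_on with
  | empty => intro _ _ _; simp
  | insert T B hT ih =>
    intro hB ha hp
    rw [card_insert_of_notMem hT] at *
    have hB' : Unif U b B := fun F hF => hB F (mem_insert_of_mem hF)
    have ih := ih hB' (by omega) (by omega)
    have hTU := hB T (mem_insert_self _ _)
    have hx : ∀ F ∈ B, ∃ x, x ∈ F ∧ x ∉ T := by
      intro F hF
      by_contra hcon
      push Not at hcon
      have : F = T := eq_of_subset_of_card_le hcon (by rw [hTU.2, (hB' F hF).2])
      exact hT (this ▸ hF)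
    choose! f hf using hx
    have hc : (U \ T).card = p := by rw [card_sdiff_of_subset hTU.1]; omega
    obtain ⟨X, hX1, hX2, hX3⟩ := exists_subsuperset_card_eq (s := B.image f) (t := U \ T)
      (n := B.card)
      (by
        intro x hx
        obtain ⟨F, hF, rfl⟩ := mem_image.1 hx
        exact mem_sdiff.2 ⟨(hB' F hF).1 (hf F hF).1, (hf F hF).2⟩)
      card_image_le (by omega)
    have key : ((powersetCard (a - B.card) ((U \ T) \ X)).image (fun S => S ∪ X)).card
        = (p - B.card).choose (a - B.card) := by
      rw [card_image_of_injOn, card_powersetCard, card_sdiff_of_subset hX2, hc, hX3]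
      intro S hS S' hS' hSS
      simp only [mem_coe, mem_powersetCard] at hS hS'
      have e1 : Disjoint S X := disjoint_of_subset_left hS.1 sdiff_disjoint
      have e2 : Disjoint S' X := disjoint_of_subset_left hS'.1 sdiff_disjoint
      simp only at hSS
      rw [← union_sdiff_cancel_right e1, hSS, union_sdiff_cancel_right e2]
    have hsub : ((powersetCard a U).filter (fun S => ∃ T ∈ B, Disjoint S T)) ∪
        ((powersetCard (a - B.card) ((U \ T) \ X)).image (fun S => S ∪ X)) ⊆
        (powersetCard a U).filter (fun S => ∃ T' ∈ insert T B, Disjoint S T') := by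
      intro S hS
      rw [mem_filter]
      rcases mem_union.1 hS with hS0 | hS0 <;> clear hS <;> rename _ => hS
      · rw [mem_filter] at hS
        obtain ⟨h1, T', h2, h3⟩ := hS
        exact ⟨h1, T', mem_insert_of_mem h2, h3⟩
      · obtain ⟨S, hS1, rfl⟩ := mem_image.1 hS
        replace hS := hS1
        rw [mem_powersetCard] at hS
        have e1 : Disjoint S X := disjoint_of_subset_left hS.1 sdiff_disjoint
        have e2 : S ∪ X ⊆ U \ T := union_subset (hS.1.trans sdiff_subset) hX2
        refine ⟨mem_powersetCard.2 ⟨e2.trans sdiff_subset, ?_⟩, T, mem_insert_self _ _, ?_⟩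
        · rw [card_union_of_disjoint e1]; omega
        · exact disjoint_of_subset_left e2 sdiff_disjoint
    have hdis : Disjoint ((powersetCard a U).filter (fun S => ∃ T ∈ B, Disjoint S T))
        ((powersetCard (a - B.card) ((U \ T) \ X)).image (fun S => S ∪ X)) := by
      rw [disjoint_left]
      intro S hS hS'
      obtain ⟨S, _, rfl⟩ := mem_image.1 hS'
      obtain ⟨_, T', hT', hd⟩ := mem_filter.1 hS
      exact disjoint_left.1 hd (mem_union_right _ (hX1 (mem_image_of_mem f hT'))) (hf T' hT').1
    have h3 := card_le_card hsub
    rw [card_union_of_disjoint hdis, key] at h3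
    have h4 : (p + 1 - B.card).choose (a - B.card) =
        (p - B.card).choose (a - (B.card + 1)) + (p - B.card).choose (a - B.card) := by
      obtain ⟨c, rfl⟩ : ∃ c, a = B.card + 1 + c := ⟨a - (B.card + 1), by omega⟩
      rw [show p + 1 - B.card = (p - B.card) + 1 by omega,
        show B.card + 1 + c - B.card = c + 1 by omega,
        show B.card + 1 + c - (B.card + 1) = c by omega, Nat.choose_succ_succ]
    rw [show p + 1 - (B.card + 1) = p - B.card by omega]
    omega

lemma count_bound {U : Finset ℕ} {a b p r : ℕ} {A B : Finset (Finset ℕ)}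
    (hU : U.card = b + p) (hA : Unif U a A) (hB : Unif U b B) (h : Cross A B)
    (hr : r ≤ B.card) (hra : r ≤ a) (hrp : r ≤ p + 1) :
    A.card + (p + 1).choose a ≤ (b + p).choose a + (p + 1 - r).choose (a - r) := by
  obtain ⟨B', hB', rfl⟩ := exists_subset_card_eq hr
  have h1 := count_aux hU B' (fun F hF => hB F (hB' hF)) hra hrp
  have h2 : A.card + ((powersetCard a U).filter (fun S => ∃ T ∈ B', Disjoint S T)).card
      ≤ (b + p).choose a := by
    rw [← hU, ← card_powersetCard, ← card_union_of_disjoint]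
    · apply card_le_card
      apply union_subset _ (filter_subset _ _)
      intro F hF
      exact mem_powersetCard.2 (hA F hF)
    · rw [disjoint_left]
      intro F hF hF'
      obtain ⟨_, T, hT, hd⟩ := mem_filter.1 hF'
      obtain ⟨x, hx⟩ := h F hF T (hB' hT)
      rw [mem_inter] at hx
      exact disjoint_left.1 hd hx.1 hx.2
  omega


lemma arith_cross_one {a q s g0 h0 h1 : ℕ} (hs : s ≤ a) (hqa : a ≤ q)
    (i1 : g0 + h0 + (q + 1).choose (a + 1) ≤
      (a + 1 + q).choose (a + 1) + (q + 1 - s).choose (a + 1 - s) + s)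
    (i2 : h1 + (q + 1).choose a ≤ (a + 1 + q).choose a + (q + 1 - s).choose (a - s)) :
    g0 + h0 + h1 + (q + 2).choose (a + 1) ≤
      (a + 1 + (q + 1)).choose (a + 1) + (q + 2 - s).choose (a + 1 - s) + s := by
  have e1 := Nat.choose_succ_succ (q + 1) a
  have e2 := Nat.choose_succ_succ (a + 1 + q) a
  have e3 : (q + 2 - s).choose (a + 1 - s) =
      (q + 1 - s).choose (a - s) + (q + 1 - s).choose (a + 1 - s) := by
    rw [show q + 2 - s = (q + 1 - s) + 1 by omega, show a + 1 - s = (a - s) + 1 by omega,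
      Nat.choose_succ_succ]
  simp only [Nat.succ_eq_add_one] at e1 e2
  rw [show a + 1 + (q + 1) = a + 1 + q + 1 by omega, e3]
  rw [show q + 2 = q + 1 + 1 by omega]
  omega

/-- Sum bound for shifted cross-intersecting families. -/
lemma cross_shifted (c : ℕ) : ∀ (U : Finset ℕ) (a p s : ℕ) (G H : Finset (Finset ℕ)),
    U.card = c → c = a + p → 1 ≤ a → a ≤ p → 1 ≤ s → (s + 1 ≤ a ∨ s = 1) →
    Unif U a G → Unif U a H → Cross G H → Shifted U G → Shifted U H →
    s ≤ G.card → s ≤ H.card →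
    G.card + H.card + (p + 1).choose a ≤ (a + p).choose a + (p + 1 - s).choose (a - s) + s := by
  induction c with
  | zero => intros; omega
  | succ c ih =>
    intro U a p s G H hU hc ha hp hs hsa hG hH hX hGs hHs hG1 hH1
    obtain ⟨a, rfl⟩ : ∃ a', a = a' + 1 := ⟨a - 1, by omega⟩
    rcases Nat.eq_or_lt_of_le hp with rfl | hlt
    · have h1 := base_cross hX hG hH (by omega)
      rw [show 2 * (a + 1) = a + 1 + (a + 1) by omega] at h1
      have e1 : (a + 1 + 1).choose (a + 1) = a + 2 := by
        rw [Nat.choose_succ_self_right]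
      have e2 : (a + 1 + 1 - s).choose (a + 1 - s) = a + 2 - s := by
        rw [show a + 1 + 1 - s = (a + 1 - s) + 1 by omega, Nat.choose_succ_self_right]
      omega
    obtain ⟨q, rfl⟩ : ∃ q, p = q + 1 := ⟨p - 1, by omega⟩
    have hne : U.Nonempty := card_pos.1 (by omega)
    set m := U.max' hne with hm
    have hmU : m ∈ U := max'_mem _ _
    have hmax : ∀ x ∈ U, x ≤ m := fun x hx => le_max' _ _ hx
    have hU' : (U.erase m).card = c := by rw [card_erase_of_mem hmU]; omega
    have low : ∀ K : Finset (Finset ℕ), Unif U (a + 1) K → Shifted U K → s ≤ K.card →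
        s ≤ (K.nonMemberSubfamily m).card := by
      intro K hK hKs hK1
      by_cases hem : K.memberSubfamily m = ∅
      · have := card_split K m
        rw [hem, card_empty] at this
        omega
      · obtain ⟨T, hT⟩ := nonempty_iff_ne_empty.2 hem
        rw [mem_memberSubfamily] at hT
        have hT2 := hK _ hT.1
        have := top_count (W := U \ insert m T) (T := insert m T) (m := m)
          (K := K.nonMemberSubfamily m) sdiff_disjoint (by
            intro x hx
            rw [mem_sdiff] at hx
            have hxm : x ≠ m := by rintro rfl; exact hx.2 (mem_insert_self _ _)
            rw [mem_nonMemberSubfamily]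
            refine ⟨hKs _ hT.1 x hx.1 m (mem_insert_self _ _) hx.2
              (lt_of_le_of_ne (hmax x hx.1) hxm), ?_⟩
            simp [hxm.symm])
        rw [card_sdiff_of_subset hT2.1, hT2.2] at this
        omega
    have hG0 := low G hG hGs hG1
    have hH0 := low H hH hHs hH1
    have i1 := ih (U.erase m) (a + 1) q s _ _ hU' (by omega) (by omega) (by omega) hs hsa
      (unif_non hG) (unif_non hH) (cross_non (m := m) hX) (shifted_non hGs) (shifted_non hHs)
      hG0 hH0
    rw [show q + 1 + 1 = q + 2 from rfl]
    have sG := card_split G m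
    have sH := card_split H m
    have one : ∀ K L : Finset (Finset ℕ), Unif U (a + 1) K → Unif U (a + 1) L → Cross K L →
        s ≤ (K.nonMemberSubfamily m).card →
        (K.nonMemberSubfamily m).card + (L.nonMemberSubfamily m).card + (q + 1).choose (a + 1) ≤
      (a + 1 + q).choose (a + 1) + (q + 1 - s).choose (a + 1 - s) + s → 
        (K.nonMemberSubfamily m).card + (L.nonMemberSubfamily m).card 
          + (L.memberSubfamily m).card + (q + 2).choose (a + 1) ≤
      (a + 1 + (q + 1)).choose (a + 1) + (q + 2 - s).choose (a + 1 - s) + s := by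
      intro K L hK hL hKL hK0 i1
      by_cases ha0 : a = 0
      · subst ha0
        obtain rfl : s = 1 := by omega
        have : L.memberSubfamily m = ∅ := by
          rw [eq_empty_iff_forall_notMem]
          intro T hT
          have h0 := (unif_mem (m := m) hL T hT).2
          rw [card_eq_zero] at h0
          subst h0
          obtain ⟨B, hB⟩ := card_pos.1 (lt_of_lt_of_le Nat.zero_lt_one hK0)
          have := cross_non_mem (m := m) hKL B hB ∅ hT
          simp at this
        rw [this]
        simp at i1 ⊢
        omega
      · exact arith_cross_one (by omega) (by omega) i1
          (count_bound (b := a + 1) (p := q) (r := s) (by omega) (unif_mem hL) (unif_non hK)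
            (cross_non_mem hKL).symm hK0 (by omega) (by omega))
    by_cases hGe : G.memberSubfamily m = ∅
    · have := one G H hG hH hX hG0 i1
      rw [hGe, card_empty] at sG
      omega
    by_cases hHe : H.memberSubfamily m = ∅
    · have := one H G hH hG hX.symm hH0 (by omega)
      rw [hHe, card_empty] at sH
      omega
    have hcm := cross_mem hX hG hH (by omega) hmax hGs
    have hGp := card_pos.2 (nonempty_iff_ne_empty.2 hGe)
    have hHp := card_pos.2 (nonempty_iff_ne_empty.2 hHe)
    rcases Nat.eq_zero_or_pos a with rfl | hapos
    · exfalso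
      obtain ⟨A, hA⟩ := card_pos.1 hGp
      obtain ⟨B, hB⟩ := card_pos.1 hHp
      obtain ⟨x, hx⟩ := hcm A hA B hB
      have := card_eq_zero.1 (unif_mem (m := m) hG A hA).2
      subst this
      simp at hx
    have i2 := ih (U.erase m) a (q + 1) 1 _ _ hU' (by omega) (by omega) (by omega) le_rfl
      (Or.inr rfl) (unif_mem hG) (unif_mem hH) hcm (shifted_mem hGs) (shifted_mem hHs) hGp hHp
    have i3 : (G.memberSubfamily m).card + (H.memberSubfamily m).card + (q + 1).choose a
        ≤ (a + 1 + q).choose a + (q + 1 - s).choose (a - s) := by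
      have e1 : (q + 1 + 1).choose a = (q + 1).choose (a - 1) + (q + 1).choose a := by
        obtain ⟨a, rfl⟩ : ∃ a', a = a' + 1 := ⟨a - 1, by omega⟩
        exact Nat.choose_succ_succ _ _
      have e2 : 0 < (q + 1 - s).choose (a - s) := Nat.choose_pos (by omega)
      rw [show a + (q + 1) = a + 1 + q by omega] at i2
      simp only [Nat.add_sub_cancel] at i2
      omega
    have := arith_cross_one (by omega) (by omega) i1 i3
    omega

/-- The bound for shifted intersecting families. -/
lemma int_shifted (c : ℕ) : ∀ (U : Finset ℕ) (k p r o : ℕ) (F : Finset (Finset ℕ)),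
    U.card = c → c = k + p → 2 ≤ k → k ≤ p → 1 ≤ r → (r + 2 ≤ k ∨ r = 1) →
    o ∈ U → (∀ x ∈ U, o ≤ x) →
    Unif U k F → Cross F F → Shifted U F → r ≤ (F.nonMemberSubfamily o).card →
    F.card + p.choose (k - 1) ≤ (k + p - 1).choose (k - 1) + (p - r).choose (k - 1 - r) + r := by
  induction c with
  | zero => intros; omega
  | succ c ih =>
    intro U k p r o F hU hc hk hp hr hrk hoU ho hF hX hS hF1
    obtain ⟨k, rfl⟩ : ∃ k', k = k' + 2 := ⟨k - 2, by omega⟩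
    rcases Nat.eq_or_lt_of_le hp with rfl | hlt
    · have h1 := base_cross hX hF hF (by omega)
      have e0 : (2 * (k + 2)).choose (k + 2) = 2 * (k + 2 + (k + 2) - 1).choose (k + 2 - 1) := by
        have := Nat.choose_succ_succ (2 * k + 3) (k + 1)
        rw [show 2 * (k + 2) = 2 * k + 3 + 1 by omega, show k + 2 + (k + 2) - 1 = 2 * k + 3 by omega,
          show k + 2 - 1 = k + 1 by omega]
        rw [Nat.choose_symm_of_eq_add (show 2 * k + 3 = (k + 1).succ + (k + 1) by omega)] at this
        simp only [Nat.succ_eq_add_one] at this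
        rw [show k + 2 = k + 1 + 1 by omega]
        omega
      have e1 : (k + 2).choose (k + 2 - 1) = k + 2 := by
        rw [show k + 2 - 1 = k + 1 by omega, Nat.choose_succ_self_right]
      have e2 : (k + 2 - r).choose (k + 2 - 1 - r) = k + 2 - r := by
        rw [show k + 2 - r = (k + 2 - 1 - r) + 1 by omega, Nat.choose_succ_self_right]
      omega
    obtain ⟨q, rfl⟩ : ∃ q, p = q + 1 := ⟨p - 1, by omega⟩
    have hne : U.Nonempty := card_pos.1 (by omega)
    set m := U.max' hne with hm
    have hmU : m ∈ U := max'_mem _ _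
    have hmax : ∀ x ∈ U, x ≤ m := fun x hx => le_max' _ _ hx
    have hU' : (U.erase m).card = c := by rw [card_erase_of_mem hmU]; omega
    have hom : o ≠ m := by
      intro h
      have : U ⊆ {m} := fun x hx => mem_singleton.2 (le_antisymm (hmax x hx) (h ▸ ho x hx))
      have := card_le_card this
      rw [card_singleton] at this
      omega
    have hoU' : o ∈ U.erase m := mem_erase.2 ⟨hom, hoU⟩
    have ho' : ∀ x ∈ U.erase m, o ≤ x := fun x hx => ho x (mem_of_mem_erase hx)
    have sF := card_split F m
    have hcm := cross_mem hX hF hF (by omega) hmax hS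
    have arith : (F.nonMemberSubfamily m).card + q.choose (k + 1) ≤
          (k + 1 + q).choose (k + 1) + (q - r).choose (k + 1 - r) + r →
        (F.memberSubfamily m).card + q.choose k ≤ (k + 1 + q).choose k + (q - r).choose (k - r) →
        r ≤ k →
        F.card + (q + 1).choose (k + 2 - 1) ≤
          (k + 2 + (q + 1) - 1).choose (k + 2 - 1) + (q + 1 - r).choose (k + 2 - 1 - r) + r := by
      intro i1 i2 hrk
      have e1 := Nat.choose_succ_succ q k
      have e2 := Nat.choose_succ_succ (k + 1 + q) k
      have e3 : (q + 1 - r).choose (k + 1 - r) =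
          (q - r).choose (k - r) + (q - r).choose (k + 1 - r) := by
        rw [show q + 1 - r = (q - r) + 1 by omega, show k + 1 - r = (k - r) + 1 by omega,
          Nat.choose_succ_succ]
      simp only [Nat.succ_eq_add_one] at e1 e2
      rw [show k + 2 - 1 = k + 1 by omega, show k + 2 + (q + 1) - 1 = k + 1 + q + 1 by omega]
      omega
    have fin : r ≤ ((F.nonMemberSubfamily m).nonMemberSubfamily o).card →
        (F.nonMemberSubfamily m).card + q.choose (k + 1) ≤
          (k + 1 + q).choose (k + 1) + (q - r).choose (k + 1 - r) + r := by
      intro h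
      have := ih (U.erase m) (k + 2) q r o _ hU' (by omega) hk (by omega) hr hrk hoU' ho'
        (unif_non hF) (cross_non (m := m) hX) (shifted_non hS) h
      rw [show k + 2 + q - 1 = k + 1 + q by omega] at this
      exact this
    by_cases hem : (F.memberSubfamily m).nonMemberSubfamily o = ∅
    · have heq : (F.nonMemberSubfamily m).nonMemberSubfamily o = F.nonMemberSubfamily o := by
        ext T
        simp only [mem_nonMemberSubfamily]
        constructor
        · rintro ⟨⟨h1, _⟩, h2⟩; exact ⟨h1, h2⟩
        · rintro ⟨h1, h2⟩
          refine ⟨⟨h1, fun hmT => ?_⟩, h2⟩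
          have : T.erase m ∈ (F.memberSubfamily m).nonMemberSubfamily o := by
            simp only [mem_nonMemberSubfamily, mem_memberSubfamily, insert_erase hmT]
            exact ⟨⟨h1, notMem_erase _ _⟩, fun h => h2 (mem_of_mem_erase h)⟩
          rw [hem] at this
          simp at this
      have hr' : r ≤ ((F.nonMemberSubfamily m).nonMemberSubfamily o).card := by rw [heq]; exact hF1
      have i1 := fin hr'
      have sM := card_split (F.memberSubfamily m) o
      rw [hem, card_empty] at sM
      have hcr : Cross ((F.memberSubfamily m).memberSubfamily o)
          ((F.nonMemberSubfamily m).nonMemberSubfamily o) :=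
        (cross_non_mem (m := o) (cross_non_mem (m := m) hX)).symm
      have u1 : Unif ((U.erase m).erase o) k ((F.memberSubfamily m).memberSubfamily o) :=
        unif_mem (unif_mem hF)
      have u2 : Unif ((U.erase m).erase o) (k + 2)
        ((F.nonMemberSubfamily m).nonMemberSubfamily o) := unif_non (unif_non hF)
      rcases Nat.eq_zero_or_pos k with rfl | hkpos
      · obtain rfl : r = 1 := by omega
        have : (F.memberSubfamily m).memberSubfamily o = ∅ := by
          rw [eq_empty_iff_forall_notMem]
          intro T hT
          have h0 := (u1 T hT).2
          rw [card_eq_zero] at h0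
          subst h0
          obtain ⟨B, hB⟩ := card_pos.1 (lt_of_lt_of_le Nat.zero_lt_one hr')
          have := hcr _ hT B hB
          simp at this
        rw [this, card_empty] at sM
        simp at i1 ⊢
        omega
      · refine arith i1 ?_ (by omega)
        have hcard : ((U.erase m).erase o).card = k + 2 + (q - 1) := by
          rw [card_erase_of_mem hoU']; omega
        have := count_bound (r := r) hcard u1 u2 hcr hr' (by omega) (by omega)
        rw [show q - 1 + 1 = q by omega, show k + 2 + (q - 1) = k + 1 + q by omega] at this
        omega
    · obtain ⟨T, hT⟩ := nonempty_iff_ne_empty.2 hem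
      have hTp := card_pos.2 ⟨T, hT⟩
      have hT' := hT
      simp only [mem_nonMemberSubfamily, mem_memberSubfamily] at hT
      have hT2 := hF _ hT.1.1
      have hoT : o ∉ insert m T := by simp [hom, hT.2]
      rcases Nat.eq_zero_or_pos k with rfl | hkpos
      · exfalso
        have hT3 : T.card = 1 := by
          have := hT2.2
          rw [card_insert_of_notMem hT.1.2] at this
          omega
        obtain ⟨t, rfl⟩ := card_eq_one.1 hT3
        have htU : t ∈ U := hT2.1 (by simp)
        have hot : o ≠ t := by rintro rfl; simp at hT
        have hmem : ({t} : Finset ℕ) ∈ F.memberSubfamily m := (mem_nonMemberSubfamily.1 hT').1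
        have h5 := shifted_mem (m := m) hS _ hmem o hoU' t (by simp) (by simpa using hot)
          (lt_of_le_of_ne (ho t htU) hot)
        obtain ⟨x, hx⟩ := hcm _ h5 _ hmem
        simp at hx
        omega
      · have hr' : r ≤ ((F.nonMemberSubfamily m).nonMemberSubfamily o).card := by
          have := top_count (W := (U \ insert m T).erase o) (T := insert m T) (m := m)
            (K := (F.nonMemberSubfamily m).nonMemberSubfamily o)
            (disjoint_of_subset_left (erase_subset _ _) sdiff_disjoint) (by
              intro x hx
              rw [mem_erase, mem_sdiff] at hx
              have hxm : x ≠ m := by rintro rfl; exact hx.2.2 (mem_insert_self _ _)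
              rw [mem_nonMemberSubfamily, mem_nonMemberSubfamily]
              refine ⟨⟨hS _ hT.1.1 x hx.2.1 m (mem_insert_self _ _) hx.2.2
                (lt_of_le_of_ne (hmax x hx.2.1) hxm), ?_⟩, ?_⟩
              · simp [hxm.symm]
              · have : o ∉ T := hT.2
                simp only [mem_insert, mem_erase, not_or, not_and]
                exact ⟨fun h => hx.1 h.symm, fun _ => ⟨hom, this⟩⟩)
          rw [card_erase_of_mem (mem_sdiff.2 ⟨hoU, hoT⟩), card_sdiff_of_subset hT2.1, hT2.2] at this
          omega
        refine arith (fin hr') ?_ (by omega)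
        have i2 := ih (U.erase m) (k + 1) (q + 1) 1 o _ hU' (by omega) (by omega) (by omega) le_rfl
          (Or.inr rfl) hoU' ho' (unif_mem hF) hcm (shifted_mem hS) hTp
        have e1 : (q + 1).choose k = q.choose (k - 1) + q.choose k := by
          obtain ⟨a, rfl⟩ : ∃ a', k = a' + 1 := ⟨k - 1, by omega⟩
          exact Nat.choose_succ_succ _ _
        have e2 : 0 < (q - r).choose (k - r) := Nat.choose_pos (by omega)
        rw [show k + 1 + (q + 1) - 1 = k + 1 + q by omega] at i2
        simp only [Nat.add_sub_cancel] at i2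
        omega


/-- Elementary shift of a set. -/
def sh (i j : ℕ) (A : Finset ℕ) : Finset ℕ :=
  if j ∈ A ∧ i ∉ A then insert i (A.erase j) else A

def mv (G : Finset (Finset ℕ)) (i j : ℕ) (A : Finset ℕ) : Finset ℕ :=
  if sh i j A ∈ G then A else sh i j A

def shiftFam (G : Finset (Finset ℕ)) (i j : ℕ) : Finset (Finset ℕ) := G.image (mv G i j)

def wt (G : Finset (Finset ℕ)) : ℕ := ∑ A ∈ G, ∑ x ∈ A, x

lemma mv_cases {G : Finset (Finset ℕ)} (i j : ℕ) {A : Finset ℕ} (hA : A ∈ G) :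
    (mv G i j A = A ∧ (j ∈ A → i ∉ A → insert i (A.erase j) ∈ G)) ∨
    (j ∈ A ∧ i ∉ A ∧ mv G i j A = insert i (A.erase j) ∧ insert i (A.erase j) ∉ G) := by
  unfold mv sh
  by_cases h : j ∈ A ∧ i ∉ A
  · rw [if_pos h]
    by_cases h2 : insert i (A.erase j) ∈ G
    · left; rw [if_pos h2]; exact ⟨rfl, fun _ _ => h2⟩
    · right; rw [if_neg h2]; exact ⟨h.1, h.2, rfl, h2⟩
  · rw [if_neg h, if_pos hA]
    left
    exact ⟨rfl, fun h1 h2 => absurd ⟨h1, h2⟩ h⟩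

lemma mv_inj (G : Finset (Finset ℕ)) (i j : ℕ) : Set.InjOn (mv G i j) G := by
  intro A hA B hB hAB
  rcases mv_cases i j hA with h1 | h1 <;> rcases mv_cases i j hB with h2 | h2
  · rw [← h1.1, hAB, h2.1]
  · exfalso
    rw [h1.1, h2.2.2.1] at hAB
    exact h2.2.2.2 (hAB ▸ hA)
  · exfalso
    rw [h2.1, h1.2.2.1] at hAB
    exact h1.2.2.2 (hAB ▸ hB)
  · rw [h1.2.2.1, h2.2.2.1] at hAB
    have e : ∀ C : Finset ℕ, j ∈ C → i ∉ C → insert j ((insert i (C.erase j)).erase i) = C := by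
      intro C hj hi
      rw [erase_insert (fun h => hi (mem_of_mem_erase h)), insert_erase hj]
    rw [← e A h1.1 h1.2.1, hAB, e B h2.1 h2.2.1]

lemma card_shiftFam (G : Finset (Finset ℕ)) (i j : ℕ) : (shiftFam G i j).card = G.card :=
  card_image_of_injOn (mv_inj G i j)

lemma unif_shift {U : Finset ℕ} {k i j : ℕ} {G : Finset (Finset ℕ)} (h : Unif U k G)
    (hi : i ∈ U) : Unif U k (shiftFam G i j) := by
  intro F hF
  obtain ⟨A, hA, rfl⟩ := mem_image.1 hF
  rcases mv_cases i j hA with h1 | h1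
  · rw [h1.1]; exact h A hA
  · rw [h1.2.2.1]
    refine ⟨insert_subset hi ((erase_subset _ _).trans (h A hA).1), ?_⟩
    rw [card_insert_of_notMem (fun h => h1.2.1 (mem_of_mem_erase h)), card_erase_of_mem h1.1,
      ← (h A hA).2]
    have := card_pos.2 ⟨j, h1.1⟩
    omega

lemma cross_half {i j : ℕ} {G H : Finset (Finset ℕ)} (h : Cross G H) {A B : Finset ℕ}
    (hA : A ∈ G) (hB : B ∈ H) (h1 : j ∈ A → i ∉ A → insert i (A.erase j) ∈ G)
    (hj : j ∈ B) (hi : i ∉ B) : (A ∩ insert i (B.erase j)).Nonempty := by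
  by_cases hiA : i ∈ A
  · exact ⟨i, by simp [hiA]⟩
  by_cases hjA : j ∈ A
  · obtain ⟨x, hx⟩ := h _ (h1 hjA hiA) B hB
    simp only [mem_inter, mem_insert, mem_erase] at hx
    refine ⟨x, ?_⟩
    simp only [mem_inter, mem_insert, mem_erase]
    rcases hx with ⟨rfl | hx, hxB⟩
    · exact absurd hxB hi
    · exact ⟨hx.2, Or.inr ⟨hx.1, hxB⟩⟩
  · obtain ⟨x, hx⟩ := h A hA B hB
    rw [mem_inter] at hx
    refine ⟨x, ?_⟩
    simp only [mem_inter, mem_insert, mem_erase]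
    refine ⟨hx.1, Or.inr ⟨?_, hx.2⟩⟩
    rintro rfl
    exact hjA hx.1

lemma cross_shift {i j : ℕ} {G H : Finset (Finset ℕ)} (h : Cross G H) :
    Cross (shiftFam G i j) (shiftFam H i j) := by
  intro A' hA' B' hB'
  obtain ⟨A, hA, rfl⟩ := mem_image.1 hA'
  obtain ⟨B, hB, rfl⟩ := mem_image.1 hB'
  rcases mv_cases i j hA with h1 | h1 <;> rcases mv_cases i j hB with h2 | h2
  · rw [h1.1, h2.1]; exact h A hA B hB
  · rw [h1.1, h2.2.2.1]
    exact cross_half h hA hB h1.2 h2.1 h2.2.1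
  · rw [h2.1, h1.2.2.1, inter_comm]
    exact cross_half h.symm hB hA h2.2 h1.1 h1.2.1
  · rw [h1.2.2.1, h2.2.2.1]
    exact ⟨i, by simp⟩

lemma sum_move {i j : ℕ} {A : Finset ℕ} (hij : i < j) (hj : j ∈ A) (hi : i ∉ A) :
    ∑ x ∈ insert i (A.erase j), x < ∑ x ∈ A, x := by
  rw [sum_insert (fun h => hi (mem_of_mem_erase h)), ← add_sum_erase A (fun x => x) hj]
  omega

lemma sum_mv_le {G : Finset (Finset ℕ)} {i j : ℕ} (hij : i < j) {A : Finset ℕ} (hA : A ∈ G) :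
    ∑ x ∈ mv G i j A, x ≤ ∑ x ∈ A, x := by
  rcases mv_cases i j hA with h1 | h1
  · rw [h1.1]
  · rw [h1.2.2.1]; exact (sum_move hij h1.1 h1.2.1).le

lemma wt_shift_le (G : Finset (Finset ℕ)) {i j : ℕ} (hij : i < j) : wt (shiftFam G i j) ≤ wt G := by
  unfold wt shiftFam
  rw [sum_image (mv_inj G i j)]
  exact sum_le_sum fun A hA => sum_mv_le hij hA

lemma wt_shift_lt (G : Finset (Finset ℕ)) {i j : ℕ} (hij : i < j) {A : Finset ℕ} (hA : A ∈ G)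
    (hj : j ∈ A) (hi : i ∉ A) (hn : insert i (A.erase j) ∉ G) : wt (shiftFam G i j) < wt G := by
  unfold wt shiftFam
  rw [sum_image (mv_inj G i j)]
  refine sum_lt_sum (fun A hA => sum_mv_le hij hA) ⟨A, hA, ?_⟩
  rcases mv_cases i j hA with h1 | h1
  · exact absurd (h1.2 hj hi) hn
  · rw [h1.2.2.1]; exact sum_move hij h1.1 h1.2.1

/-- Sum bound for cross-intersecting families. -/
lemma cross_bound (w : ℕ) : ∀ (U : Finset ℕ) (a p s : ℕ) (G H : Finset (Finset ℕ)),
    wt G + wt H = w →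
    U.card = a + p → 1 ≤ a → a ≤ p → 1 ≤ s → s + 1 ≤ a →
    Unif U a G → Unif U a H → Cross G H → s ≤ G.card → s ≤ H.card →
    G.card + H.card + (p + 1).choose a ≤ (a + p).choose a + (p + 1 - s).choose (a - s) + s := by
  induction w using Nat.strong_induction_on with
  | _ w ih =>
    intro U a p s G H hw hU ha hp hs hsa hG hH hX hG1 hH1
    have step : ∀ i j, i ∈ U → wt (shiftFam G i j) + wt (shiftFam H i j) < w →
        G.card + H.card + (p + 1).choose a ≤
          (a + p).choose a + (p + 1 - s).choose (a - s) + s := by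
      intro i j hi hlt
      have := ih _ hlt U a p s _ _ rfl hU ha hp hs hsa (unif_shift hG hi) (unif_shift hH hi)
        (cross_shift hX) (by rwa [card_shiftFam]) (by rwa [card_shiftFam])
      rwa [card_shiftFam, card_shiftFam] at this
    by_cases hGs : Shifted U G
    · by_cases hHs : Shifted U H
      · exact cross_shifted _ U a p s G H rfl hU ha hp hs (Or.inl hsa) hG hH hX hGs hHs hG1 hH1
      · unfold Shifted at hHs
        push Not at hHs
        obtain ⟨A, hA, i, hi, j, hj, hiA, hij, hn⟩ := hHs
        apply step i j hi
        have := wt_shift_lt H hij hA hj hiA hn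
        have := wt_shift_le G hij
        omega
    · unfold Shifted at hGs
      push Not at hGs
      obtain ⟨A, hA, i, hi, j, hj, hiA, hij, hn⟩ := hGs
      apply step i j hi
      have := wt_shift_lt G hij hA hj hiA hn
      have := wt_shift_le H hij
      omega

lemma choose_mono_both (N K t : ℕ) (htK : t ≤ K) (hKN : K ≤ N) :
    (N - t).choose (K - t) ≤ N.choose K := by
  induction t with
  | zero => simp
  | succ t ih =>
    refine le_trans ?_ (ih (by omega))
    rw [show N - t = (N - (t + 1)) + 1 by omega, show K - t = (K - (t + 1)) + 1 by omega,
      Nat.choose_succ_succ]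
    omega

lemma choose_convex (N K s e : ℕ) (hs : 1 ≤ s) (hse : s + e ≤ K) (hKN : K ≤ N) :
    (N - (e + 1)).choose (K - (e + 1)) + (N - s).choose (K - s) ≤
      (N - 1).choose (K - 1) + (N - (s + e)).choose (K - (s + e)) := by
  induction e with
  | zero => simp
  | succ e ih =>
    have ih := ih (by omega)
    have st : ∀ j, j + 1 ≤ K → (N - j).choose (K - j) =
        (N - (j + 1)).choose (K - (j + 1)) + (N - (j + 1)).choose (K - j) := by
      intro j hj
      rw [show N - j = (N - (j + 1)) + 1 by omega, show K - j = (K - (j + 1)) + 1 by omega,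
        Nat.choose_succ_succ]
    have h1 := st (e + 1) (by omega)
    have h2 := st (s + e) (by omega)
    have h3 : (N - (s + e + 1)).choose (K - (s + e)) ≤ (N - (e + 1 + 1)).choose (K - (e + 1)) := by
      have := choose_mono_both (N - (e + 1 + 1)) (K - (e + 1)) (s - 1) (by omega)
      by_cases hle : K - (e + 1) ≤ N - (e + 1 + 1)
      · have := this hle
        rwa [show N - (e + 1 + 1) - (s - 1) = N - (s + e + 1) by omega,
          show K - (e + 1) - (s - 1) = K - (s + e) by omega] at this
      · rw [Nat.choose_eq_zero_of_lt (by omega)]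
        omega
    rw [show s + (e + 1) = s + e + 1 by omega]
    omega

lemma mem_non_comm (F : Finset (Finset ℕ)) {i j : ℕ} (hij : i ≠ j) :
    (F.nonMemberSubfamily j).memberSubfamily i = (F.memberSubfamily i).nonMemberSubfamily j := by
  ext T
  simp only [mem_nonMemberSubfamily, mem_memberSubfamily, mem_insert, not_or]
  tauto

/-- The case when almost all sets meet a fixed pair. -/
lemma break_bound {U : Finset ℕ} {k p r i j : ℕ} {F : Finset (Finset ℕ)}
    (hU : U.card = k + p) (hp : k + 1 ≤ p) (hr : 1 ≤ r) (hrk : r + 2 ≤ k)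
    (hi : i ∈ U) (hj : j ∈ U) (hij : i ≠ j) (hF : Unif U k F) (hX : Cross F F)
    (hdi : r ≤ (F.nonMemberSubfamily i).card) (hdj : r ≤ (F.nonMemberSubfamily j).card)
    (he : ((F.nonMemberSubfamily i).nonMemberSubfamily j).card < r) :
    F.card + p.choose (k - 1) ≤ (k + p - 1).choose (k - 1) + (p - r).choose (k - 1 - r) + r := by
  obtain ⟨k, rfl⟩ : ∃ k', k = k' + 2 := ⟨k - 2, by omega⟩
  obtain ⟨e, hee⟩ : ∃ e, e = ((F.nonMemberSubfamily i).nonMemberSubfamily j).card := ⟨_, rfl⟩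
  have hjU : j ∈ U.erase i := mem_erase.2 ⟨hij.symm, hj⟩
  have hV : ((U.erase i).erase j).card = k + p := by
    rw [card_erase_of_mem hjU, card_erase_of_mem hi]; omega
  have s0 := card_split F i
  have s1 := card_split (F.memberSubfamily i) j
  have s2 := card_split (F.nonMemberSubfamily i) j
  have s3 := card_split (F.nonMemberSubfamily j) i
  have hcomm : (F.nonMemberSubfamily j).nonMemberSubfamily i =
      (F.nonMemberSubfamily i).nonMemberSubfamily j := by
    ext T
    simp only [mem_nonMemberSubfamily]
    tauto
  rw [mem_non_comm F hij, hcomm] at s3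
  have c1 : Cross ((F.memberSubfamily i).nonMemberSubfamily j)
      ((F.nonMemberSubfamily i).memberSubfamily j) := by
    have := cross_non_mem (m := j) (cross_non_mem (m := i) hX).symm
    exact this
  have c2 : Cross ((F.memberSubfamily i).memberSubfamily j)
      ((F.nonMemberSubfamily i).nonMemberSubfamily j) :=
    (cross_non_mem (m := j) (cross_non_mem (m := i) hX)).symm
  have b1 := cross_bound _ ((U.erase i).erase j) (k + 1) (p - 1) (r - e) _ _ rfl (by omega)
    (by omega) (by omega) (by omega) (by omega) (unif_non (unif_mem hF)) (unif_mem (unif_non hF))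
    c1 (by omega) (by omega)
  have b2 := count_bound (U := (U.erase i).erase j) (a := k) (b := k + 2) (p := p - 2) (r := e)
    (by omega) (unif_mem (unif_mem hF)) (unif_non (unif_non hF)) c2 hee.le (by omega) (by omega)
  have cv := choose_convex p (k + 1) (r - e) e (by omega) (by omega) (by omega)
  have e2 := Nat.choose_succ_succ (k + p) k
  simp only [Nat.succ_eq_add_one] at e2
  rw [show p - 1 + 1 = p by omega, show k + 1 + (p - 1) = k + p by omega] at b1
  rw [show p - 2 + 1 = p - 1 by omega, show k + 2 + (p - 2) = k + p by omega,
    show p - 1 - e = p - (e + 1) by omega, show k - e = k + 1 - (e + 1) by omega] at b2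
  rw [show r - e + e = r by omega, show k + 1 - 1 = k by omega] at cv
  rw [show k + 2 - 1 = k + 1 by omega, show k + 2 + p - 1 = k + p + 1 by omega]
  omega

/-- The bound for intersecting families with diversity at least `r`. -/
lemma int_bound (w : ℕ) : ∀ (U : Finset ℕ) (k p r : ℕ) (F : Finset (Finset ℕ)),
    wt F = w → U.card = k + p → k + 1 ≤ p → 1 ≤ r → r + 2 ≤ k →
    Unif U k F → Cross F F → (∀ x ∈ U, r ≤ (F.nonMemberSubfamily x).card) →
    F.card + p.choose (k - 1) ≤ (k + p - 1).choose (k - 1) + (p - r).choose (k - 1 - r) + r := by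
  induction w using Nat.strong_induction_on with
  | _ w ih =>
    intro U k p r F hw hU hp hr hrk hF hX hd
    by_cases hS : Shifted U F
    · have hne : U.Nonempty := card_pos.1 (by omega)
      exact int_shifted _ U k p r (U.min' hne) F rfl hU (by omega) (by omega) hr (Or.inl hrk)
        (min'_mem _ _) (fun x hx => min'_le _ _ hx) hF hX hS (hd _ (min'_mem _ _))
    · unfold Shifted at hS
      push Not at hS
      obtain ⟨A, hA, i, hi, j, hj, hiA, hij, hn⟩ := hS
      have hjU : j ∈ U := (hF A hA).1 hj
      by_cases hd' : ∀ x ∈ U, r ≤ ((shiftFam F i j).nonMemberSubfamily x).card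
      · have := ih _ (hw ▸ wt_shift_lt F hij hA hj hiA hn) U k p r _ rfl hU hp hr hrk
          (unif_shift hF hi) (cross_shift hX) hd'
        rwa [card_shiftFam] at this
      · push Not at hd'
        obtain ⟨x, hxU, hx⟩ := hd'
        have himg : ∀ K : Finset (Finset ℕ), K ⊆ F → (∀ T ∈ K, x ∉ mv F i j T) →
            K.card ≤ ((shiftFam F i j).nonMemberSubfamily x).card := by
          intro K hK hKx
          refine card_le_card_of_injOn (mv F i j) ?_ ((mv_inj F i j).mono hK)
          intro T hT
          rw [mem_coe, mem_nonMemberSubfamily]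
          exact ⟨mem_image_of_mem _ (hK hT), hKx T hT⟩
        have hxi : x = i := by
          by_contra hxi
          have h1 := himg (F.nonMemberSubfamily x) (filter_subset _ _) (by
            intro T hT
            rw [mem_nonMemberSubfamily] at hT
            rcases mv_cases i j hT.1 with h1 | h1
            · rw [h1.1]; exact hT.2
            · rw [h1.2.2.1]
              simp [hxi, hT.2])
          have := hd x hxU
          omega
        subst hxi
        refine break_bound hU hp hr hrk hi hjU hij.ne hF hX (hd _ hi) (hd _ hjU) ?_
        refine lt_of_le_of_lt (himg _ ?_ ?_) hx
        · exact (filter_subset _ _).trans (filter_subset _ _)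
        · intro T hT
          rw [mem_nonMemberSubfamily, mem_nonMemberSubfamily] at hT
          rcases mv_cases x j hT.1.1 with h1 | h1
          · rw [h1.1]; exact hT.1.2
          · exact absurd h1.1 hT.2

end DivBound

theorem stmt_17 (n k r : ℕ) (hk : 3 ≤ k) (hn : 2 * k < n) (hr0 : 1 ≤ r)
    (𝓕 : Finset (Finset ℕ))
    (h𝓕 : ∀ F ∈ 𝓕, F ⊆ Finset.Icc 1 n ∧ F.card = k)
    (hint : ∀ F ∈ 𝓕, ∀ F' ∈ 𝓕, (F ∩ F').Nonempty)
    (hdiv : ∀ i ∈ Finset.Icc 1 n, r ≤ (𝓕.filter (fun F => i ∉ F)).card) :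
    (r ≤ k - 2 →
      𝓕.card ≤
        (n - 1).choose (k - 1) - (n - k).choose (k - 1) +
          (n - k - r).choose (k - r - 1) + r) ∧
    (k - 1 ≤ r → r ≤ n - k →
      𝓕.card ≤ (n - 1).choose (k - 1) - (n - k).choose (k - 1) + n - k) := by
  have main : ∀ s, 1 ≤ s → s + 2 ≤ k → s ≤ r →
      𝓕.card + (n - k).choose (k - 1) ≤
        (n - 1).choose (k - 1) + (n - k - s).choose (k - 1 - s) + s := by
    intro s h1 h2 h3
    have := DivBound.int_bound _ (Finset.Icc 1 n) k (n - k) s 𝓕 rfl (by simp; omega) (by omega)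
      h1 h2 h𝓕 hint (fun x hx => h3.trans (hdiv x hx))
    rwa [show k + (n - k) - 1 = n - 1 by omega] at this
  have hmono : (n - k).choose (k - 1) ≤ (n - 1).choose (k - 1) :=
    Nat.choose_le_choose _ (by omega)
  constructor
  · intro hr
    have := main r hr0 (by omega) le_rfl
    rw [show k - 1 - r = k - r - 1 by omega] at this
    omega
  · intro hr hr2
    have := main (k - 2) (by omega) (by omega) (by omega)
    rw [show k - 1 - (k - 2) = 1 by omega, Nat.choose_one_right] at this
    omega
end
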